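/- arXiv:2510.19417 — 2 statements merged into one kernel-verified Lean document; each statement's English description precedes it below -/
import Mathlib

section
/- Let p be an odd prime, k ∈ ℕ, and p^k ≤ j ≤ p^{k+1} − 1. Then the j-th diagonal (Φ_p^∞(A)[n, n+j])_{n≥0} of the two-dimensional fixed point Φ_p^∞(A) is eventually periodic, and its minimal eventual period equals 2p^{k+1}. -/
namespace EscapeOfMass

/-- The 12-letter alphabet `{A, B, F, 0, E_N, E_E, E_S, E_W, C_NE, C_SE, C_SW, C_NW}`
used to generate the profile of the number wall of the `p`-Cantor sequence
(`Z` denotes the letter `0`). -/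
inductive NWLetter : Type
  | A | B | F | Z | EN | EE | ES | EW | CNE | CSE | CSW | CNW
  deriving DecidableEq, Repr

open NWLetter

/-- The two-dimensional uniform `[p,p]`-morphism `Φ_p`: `Phi p x i j` is the entry in
row `i` and column `j` (for `0 ≤ i, j ≤ p − 1`) of the `p × p` array `Φ_p(x)`. -/
def Phi (p : ℕ) : NWLetter → ℕ → ℕ → NWLetter
  | .A, i, j =>
      if i % 2 = 0 then (if j % 2 = 0 then .A else .Z)
      else (if j % 2 = 0 then .F else .B)
  | .B, i, j =>
      if i % 2 = 0 then (if j % 2 = 0 then .B else .F)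
      else (if j % 2 = 0 then .Z else .A)
  | .Z, _, _ => .Z
  | .F, i, j =>
      if i = 0 then (if j = 0 then .CNW else if j = p - 1 then .CNE else .EN)
      else if i = p - 1 then (if j = 0 then .CSW else if j = p - 1 then .CSE else .ES)
      else if j = 0 then .EW else if j = p - 1 then .EE else .Z
  | .EN, i, _ => if i = 0 then .EN else .Z
  | .EE, _, j => if j = p - 1 then .EE else .Z
  | .ES, i, _ => if i = p - 1 then .ES else .Z
  | .EW, _, j => if j = 0 then .EW else .Z
  | .CNE, i, j =>
      if i = 0 then (if j = p - 1 then .CNE else .EN)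
      else if j = p - 1 then .EE else .Z
  | .CNW, i, j =>
      if i = 0 then (if j = 0 then .CNW else .EN)
      else if j = 0 then .EW else .Z
  | .CSE, i, j =>
      if i = p - 1 then (if j = p - 1 then .CSE else .ES)
      else if j = p - 1 then .EE else .Z
  | .CSW, i, j =>
      if i = p - 1 then (if j = 0 then .CSW else .ES)
      else if j = 0 then .EW else .Z

/-- `PhiIter p k x i j` is the `(i, j)` entry of the `p^k × p^k` array `Φ_p^k(x)`,
obtained by applying `Φ_p` entrywise and assembling the resulting `p × p` blocks. -/
def PhiIter (p : ℕ) : ℕ → NWLetter → ℕ → ℕ → NWLetter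
  | 0, x, _, _ => x
  | k + 1, x, i, j => Phi p (PhiIter p k x (i / p) (j / p)) (i % p) (j % p)

/-- The two-dimensional fixed point `Φ_p^∞(A)`. -/
def PhiInf (p : ℕ) (i j : ℕ) : NWLetter := PhiIter p (i + j + 1) .A i j


/-- `IsEventualPeriod p j ℓ`: `ℓ` is an eventual period of the `j`-th diagonal
`n ↦ Φ_p^∞(A)[n, n + j]` of the fixed point `Φ_p^∞(A)`. -/
def IsEventualPeriod (p j ℓ : ℕ) : Prop :=
  ∃ N : ℕ, ∀ n : ℕ, N ≤ n → PhiInf p (n + ℓ) (n + ℓ + j) = PhiInf p n (n + j)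

theorem PhiIter_succ_stable (p : ℕ) (hp : 0 < p) : ∀ k i j, i < p ^ k → j < p ^ k →
    PhiIter p (k + 1) .A i j = PhiIter p k .A i j := by
  intro k
  induction k with
  | zero =>
    intro i j hi hj
    have hi : i = 0 := by simpa using hi
    have hj : j = 0 := by simpa using hj
    subst hi; subst hj
    simp [PhiIter, Phi]
  | succ k ih =>
    intro i j hi hj
    rw [PhiIter, ih, ← PhiIter]
    · exact Nat.div_lt_of_lt_mul (by rwa [pow_succ'] at hi)
    · exact Nat.div_lt_of_lt_mul (by rwa [pow_succ'] at hj)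

theorem PhiIter_stable (p : ℕ) (hp : 0 < p) (k d i j : ℕ) (hi : i < p ^ k) (hj : j < p ^ k) :
    PhiIter p (k + d) .A i j = PhiIter p k .A i j := by
  induction d with
  | zero => rfl
  | succ d ih =>
    have h : p ^ k ≤ p ^ (k + d) := Nat.pow_le_pow_right hp (by omega)
    rw [← add_assoc, PhiIter_succ_stable p hp _ _ _ (by omega) (by omega), ih]

theorem PhiInf_rec (p : ℕ) (hp : 2 ≤ p) (i j : ℕ) :
    PhiInf p i j = Phi p (PhiInf p (i / p) (j / p)) (i % p) (j % p) := by
  have hi := Nat.div_le_self i p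
  have hj := Nat.div_le_self j p
  have hlt : i / p + j / p + 1 < p ^ (i / p + j / p + 1) := Nat.lt_pow_self (by omega)
  have hlt2 : i + j + 1 < p ^ (i + j + 1) := Nat.lt_pow_self (by omega)
  unfold PhiInf
  rw [← PhiIter_succ_stable p (by omega) (i + j + 1) i j (by omega) (by omega), PhiIter]
  congr 1
  rw [← PhiIter_stable p (by omega) (i / p + j / p + 1) (i + j - i / p - j / p)
    (i / p) (j / p) (lt_of_le_of_lt (by rw [add_assoc]; exact Nat.le_add_right _ _) hlt)
    (lt_of_le_of_lt (by rw [add_right_comm]; exact Nat.le_add_left _ _) hlt)]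
  congr 1
  omega

theorem PhiInf_diag (p : ℕ) (hp : 2 ≤ p) (hodd : p % 2 = 1) (q : ℕ) :
    (q % 2 = 0 → PhiInf p q q = .A) ∧ (q % 2 = 1 → PhiInf p q q = .B) := by
  induction q using Nat.strong_induction_on with
  | _ q ih =>
    rcases Nat.eq_zero_or_pos q with h0 | h0
    · subst h0
      refine ⟨fun _ => ?_, fun h => by omega⟩
      simp [PhiInf, PhiIter, Phi]
    · have := ih (q / p) (Nat.div_lt_self h0 (by omega))
      rw [PhiInf_rec p hp]
      have e : q % 2 = (q / p + q % p) % 2 := by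
        conv_lhs => rw [← Nat.div_add_mod q p, Nat.add_mod, Nat.mul_mod, hodd]
        simp [Nat.add_mod]
      rcases Nat.mod_two_eq_zero_or_one (q / p) with h | h
      · rw [this.1 h]
        refine ⟨fun h1 => ?_, fun h1 => ?_⟩
        · have : q % p % 2 = 0 := by omega
          simp [Phi, this]
        · have : q % p % 2 = 1 := by omega
          simp [Phi, this]
      · rw [this.2 h]
        refine ⟨fun h1 => ?_, fun h1 => ?_⟩
        · have : q % p % 2 = 1 := by omega
          simp [Phi, this]
        · have : q % p % 2 = 0 := by omega
          simp [Phi, this]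

theorem PhiInf_off (p : ℕ) (hp : 3 ≤ p) (hodd : p % 2 = 1) (q : ℕ) :
    (q % 2 = 0 → PhiInf p q (q + 1) = .Z) ∧
    (q % 2 = 1 → PhiInf p q (q + 1) = .F ∨ PhiInf p q (q + 1) = .CSW) := by
  induction q using Nat.strong_induction_on with
  | _ q ih =>
    have e : q % 2 = (q / p + q % p) % 2 := by
      conv_lhs => rw [← Nat.div_add_mod q p, Nat.add_mod, Nat.mul_mod, hodd]
      simp [Nat.add_mod]
    have hm : q % p < p := Nat.mod_lt _ (by omega)
    have hda := Nat.div_add_mod q p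
    rw [PhiInf_rec p (by omega)]
    by_cases hl : q % p = p - 1
    · have h0 : 0 < q := by
        rcases Nat.eq_zero_or_pos q with h | h
        · subst h; simp at hl; omega
        · exact h
      have := ih (q / p) (Nat.div_lt_self h0 (by omega))
      have e1 : q + 1 = p * (q / p + 1) := by rw [mul_add, mul_one]; omega
      have e2 : (q + 1) / p = q / p + 1 := by
        rw [e1, Nat.mul_div_cancel_left _ (by omega : 0 < p)]
      have e3 : (q + 1) % p = 0 := by rw [e1]; simp
      rw [e2, e3, hl]
      refine ⟨fun h1 => ?_, fun h1 => ?_⟩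
      · rw [this.1 (by omega)]; rfl
      · right
        have hp1 : ¬ (p - 1 = 0) := by omega
        rcases this.2 (by omega) with h | h <;> rw [h] <;> simp [Phi, hp1]
    · have hq := PhiInf_diag p (by omega) hodd (q / p)
      have e1 : q + 1 = (q % p + 1) + p * (q / p) := by omega
      have e2 : (q + 1) / p = q / p := by
        rw [e1, Nat.add_mul_div_left _ _ (by omega : 0 < p), Nat.div_eq_of_lt (by omega)]
        simp
      have e3 : (q + 1) % p = q % p + 1 := by
        conv_lhs => rw [e1]
        rw [Nat.add_mul_mod_self_left, Nat.mod_eq_of_lt (by omega)]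
      rw [e2, e3]
      rcases Nat.mod_two_eq_zero_or_one (q / p) with h | h
      · rw [hq.1 h]
        refine ⟨fun h1 => ?_, fun h1 => ?_⟩
        · have h2 : q % p % 2 = 0 := by omega
          have h3 : (q % p + 1) % 2 = 1 := by omega
          simp [Phi, h2, h3]
        · have h2 : q % p % 2 = 1 := by omega
          have h3 : (q % p + 1) % 2 = 0 := by omega
          simp [Phi, h2, h3]
      · rw [hq.2 h]
        refine ⟨fun h1 => ?_, fun h1 => ?_⟩
        · have h2 : q % p % 2 = 1 := by omega
          have h3 : (q % p + 1) % 2 = 0 := by omega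
          simp [Phi, h2, h3]
        · have h2 : q % p % 2 = 0 := by omega
          have h3 : (q % p + 1) % 2 = 1 := by omega
          simp [Phi, h2, h3]

/-- Normalisation of letters that agree strictly below the diagonal. -/
def nu : NWLetter → NWLetter
  | .F => .CSW
  | .CNW => .EW
  | .CSE => .ES
  | x => x

theorem Phi_nu_lt (p : ℕ) (x : NWLetter) (i j : ℕ) (h : j < i) (hi : i < p) :
    Phi p x i j = Phi p (nu x) i j := by
  have h1 : i ≠ 0 := by omega
  have h2 : j ≠ p - 1 := by omega
  cases x <;> simp [Phi, nu, h1, h2]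

theorem nu_Phi_diag (p : ℕ) (hp : 2 ≤ p) (x : NWLetter) (i : ℕ) :
    nu (Phi p x i i) = nu (Phi p (nu x) i i) := by
  have h3 : p - 1 ≠ 0 := by omega
  by_cases h1 : i = 0
  · subst h1
    cases x <;> simp [Phi, nu, h3.symm]
  · by_cases h2 : i = p - 1
    · subst h2
      cases x <;> simp [Phi, nu, h3]
    · cases x <;> simp [Phi, nu, h1, h2]

theorem div_block (p t m r : ℕ) (hp : 0 < p) :
    (m * p ^ (t + 1) + r) / p = m * p ^ t + r / p ∧ (m * p ^ (t + 1) + r) % p = r % p := by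
  have : m * p ^ (t + 1) + r = r + p * (m * p ^ t) := by ring
  rw [this, Nat.add_mul_div_left _ _ hp, Nat.add_mul_mod_self_left]
  exact ⟨by ring, rfl⟩

theorem block_eq (p : ℕ) (hp : 2 ≤ p) (m n m' n' : ℕ) (h : PhiInf p m n = PhiInf p m' n') (t : ℕ) :
    ∀ r s, r < p ^ t → s < p ^ t →
    PhiInf p (m * p ^ t + r) (n * p ^ t + s) = PhiInf p (m' * p ^ t + r) (n' * p ^ t + s) := by
  induction t with
  | zero =>
    intro r s hr hs
    have hr : r = 0 := by simpa using hr
    have hs : s = 0 := by simpa using hs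
    subst hr; subst hs
    simpa using h
  | succ t ih =>
    intro r s hr hs
    have hp0 : 0 < p := by omega
    rw [PhiInf_rec p hp, PhiInf_rec p hp (m' * p ^ (t + 1) + r)]
    simp only [(div_block p t _ _ hp0).1, (div_block p t _ _ hp0).2]
    rw [ih]
    · exact Nat.div_lt_of_lt_mul (by rwa [pow_succ'] at hr)
    · exact Nat.div_lt_of_lt_mul (by rwa [pow_succ'] at hs)

theorem block_nu (p : ℕ) (hp : 2 ≤ p) (m n m' n' : ℕ)
    (h : nu (PhiInf p m n) = nu (PhiInf p m' n')) (t : ℕ) :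
    ∀ r s, r < p ^ t → s < p ^ t →
    (s < r → PhiInf p (m * p ^ t + r) (n * p ^ t + s) =
      PhiInf p (m' * p ^ t + r) (n' * p ^ t + s)) ∧
    (r = s → nu (PhiInf p (m * p ^ t + r) (n * p ^ t + s)) =
      nu (PhiInf p (m' * p ^ t + r) (n' * p ^ t + s))) := by
  induction t with
  | zero =>
    intro r s hr hs
    have hr : r = 0 := by simpa using hr
    have hs : s = 0 := by simpa using hs
    subst hr; subst hs
    simpa using h
  | succ t ih =>
    intro r s hr hs
    have hp0 : 0 < p := by omega
    rw [PhiInf_rec p hp, PhiInf_rec p hp (m' * p ^ (t + 1) + r)]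
    simp only [(div_block p t _ _ hp0).1, (div_block p t _ _ hp0).2]
    have ih := ih (r / p) (s / p) (Nat.div_lt_of_lt_mul (by rwa [pow_succ'] at hr))
      (Nat.div_lt_of_lt_mul (by rwa [pow_succ'] at hs))
    constructor
    · intro hsr
      rcases (Nat.div_le_div_right hsr.le : s / p ≤ r / p).lt_or_eq with hlt | heq
      · rw [ih.1 hlt]
      · have h1 := Nat.div_add_mod r p
        have h2 := Nat.div_add_mod s p
        rw [heq] at h2
        rw [Phi_nu_lt p _ (r % p) (s % p) (by omega) (Nat.mod_lt _ hp0), ih.2 heq.symm,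
          ← Phi_nu_lt p _ (r % p) (s % p) (by omega) (Nat.mod_lt _ hp0)]
    · intro hrs
      subst hrs
      rw [nu_Phi_diag p hp, ih.2 rfl, ← nu_Phi_diag p hp]

theorem row_closed (p : ℕ) (hp : 2 ≤ p) (S : NWLetter → Prop)
    (hS : ∀ x j, S x → S (Phi p x 0 j)) (m t : ℕ) :
    ∀ N, S (PhiInf p m (N / p ^ t)) → S (PhiInf p (m * p ^ t) N) := by
  induction t with
  | zero => intro N h; simpa using h
  | succ t ih =>
    intro N h
    have hp0 : 0 < p := by omega
    have := div_block p t m 0 hp0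
    simp only [add_zero, Nat.zero_div, Nat.zero_mod] at this
    rw [PhiInf_rec p hp, this.1, this.2]
    apply hS
    apply ih
    rwa [Nat.div_div_eq_div_mul, ← pow_succ']

theorem period_mul {p j l : ℕ} (h : IsEventualPeriod p j l) (c : ℕ) :
    IsEventualPeriod p j (l * c) := by
  obtain ⟨N, hN⟩ := h
  refine ⟨N, ?_⟩
  induction c with
  | zero => intro n _; simp
  | succ c ih =>
    intro n hn
    have := hN (n + l * c) (by omega)
    rw [← ih n hn, ← this]
    congr 1 <;> ring

theorem period_gcd {p j l L : ℕ} (hl : IsEventualPeriod p j l) (hL : IsEventualPeriod p j L)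
    (hlt : Nat.gcd l L < L) : IsEventualPeriod p j (Nat.gcd l L) := by
  obtain ⟨m, _, hm⟩ := Nat.exists_mul_mod_eq_gcd hlt
  obtain ⟨N, hN⟩ := period_mul hl m
  obtain ⟨M, hM⟩ := period_mul hL (l * m / L)
  refine ⟨max N M, fun n hn => ?_⟩
  have h1 := hN n (le_trans (le_max_left _ _) hn)
  have h2 := hM (n + Nat.gcd l L) (le_trans (le_trans (le_max_right _ _) hn) (Nat.le_add_right _ _))
  have h3 := Nat.div_add_mod (l * m) L
  rw [hm] at h3
  rw [← h1, ← h2]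
  congr 1 <;> omega

theorem period_two (p : ℕ) (hp : 3 ≤ p) (hodd : p % 2 = 1) (t j : ℕ) (hj : j < p ^ t) :
    IsEventualPeriod p j (2 * p ^ t) := by
  refine ⟨0, fun n _ => ?_⟩
  have hP : 0 < p ^ t := by positivity
  generalize hq : n / p ^ t = q
  generalize hr : n % p ^ t = r
  have hn : n = q * p ^ t + r := by
    have := Nat.div_add_mod n (p ^ t)
    rw [hq, hr, mul_comm] at this
    exact this.symm
  have hrl : r < p ^ t := hr ▸ Nat.mod_lt _ hP
  subst hn
  by_cases hc : r + j < p ^ t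
  · have key := block_eq p (by omega) (q + 2) (q + 2) q q (by
      have h1 := PhiInf_diag p (by omega) hodd q
      have h2 := PhiInf_diag p (by omega) hodd (q + 2)
      rcases Nat.mod_two_eq_zero_or_one q with h | h
      · rw [h1.1 h, h2.1 (by omega)]
      · rw [h1.2 h, h2.2 (by omega)]) t r (r + j) hrl hc
    convert key using 2 <;> ring
  · have key := (block_nu p (by omega) (q + 2) (q + 2 + 1) q (q + 1) (by
      have h1 := PhiInf_off p (by omega) hodd q
      have h2 := PhiInf_off p (by omega) hodd (q + 2)
      rcases Nat.mod_two_eq_zero_or_one q with h | h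
      · rw [h1.1 h, h2.1 (by omega)]
      · rcases h1.2 h with h3 | h3 <;> rcases h2.2 (by omega) with h4 | h4 <;>
          rw [h3, h4] <;> rfl) t r (r + j - p ^ t) hrl (by omega)).1 (by omega)
    have e : r + j = (r + j - p ^ t) + p ^ t := by omega
    generalize r + j - p ^ t = s at *
    convert key using 2
    · ring
    · rw [show q * p ^ t + r + 2 * p ^ t + j = q * p ^ t + 2 * p ^ t + (r + j) by ring, e]; ring
    · rw [add_assoc, e]; ring

/-- Letters of a top row under `A`. -/
def S0 (x : NWLetter) : Prop := x = .A ∨ x = .Z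
/-- Letters of a top row under `B`. -/
def S1 (x : NWLetter) : Prop := x = .B ∨ x = .F ∨ x = .EN ∨ x = .CNW ∨ x = .CNE
/-- Letters of a top row under a bottom edge. -/
def S2 (x : NWLetter) : Prop := x = .ES ∨ x = .CSW ∨ x = .EW ∨ x = .Z

theorem S0_closed (p : ℕ) (x : NWLetter) (j : ℕ) (h : S0 x) : S0 (Phi p x 0 j) := by
  rcases h with h | h <;> subst h <;> simp only [Phi, S0] <;> (repeat' split) <;> simp_all

theorem S1_closed (p : ℕ) (x : NWLetter) (j : ℕ) (h : S1 x) : S1 (Phi p x 0 j) := by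
  rcases h with h | h | h | h | h <;> subst h <;> simp only [Phi, S1] <;>
    (repeat' split) <;> simp_all

theorem S2_closed (p : ℕ) (hp : 2 ≤ p) (x : NWLetter) (j : ℕ) (h : S2 x) :
    S2 (Phi p x 0 j) := by
  have h3 : ¬ (0 = p - 1) := by omega
  rcases h with h | h | h | h <;> subst h <;> simp only [Phi, S2, h3, if_false] <;>
    (repeat' split) <;> simp_all

theorem point_even (p : ℕ) (hp : 3 ≤ p) (hodd : p % 2 = 1) (t j q : ℕ) (hj : j < p ^ t)
    (hq : q % 2 = 0) : S0 (PhiInf p (q * p ^ t) (q * p ^ t + j)) := by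
  have hP : 0 < p ^ t := by positivity
  apply row_closed p (by omega) S0 (S0_closed p)
  have : (q * p ^ t + j) / p ^ t = q := by
    rw [add_comm, Nat.add_mul_div_right _ _ hP, Nat.div_eq_of_lt hj]; simp
  rw [this, (PhiInf_diag p (by omega) hodd q).1 hq]
  simp [S0]

theorem point_odd (p : ℕ) (hp : 3 ≤ p) (hodd : p % 2 = 1) (t j q : ℕ) (hj : j < p ^ t)
    (hq : q % 2 = 1) : S1 (PhiInf p (q * p ^ t) (q * p ^ t + j)) := by
  have hP : 0 < p ^ t := by positivity
  apply row_closed p (by omega) S1 (S1_closed p)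
  have : (q * p ^ t + j) / p ^ t = q := by
    rw [add_comm, Nat.add_mul_div_right _ _ hP, Nat.div_eq_of_lt hj]; simp
  rw [this, (PhiInf_diag p (by omega) hodd q).2 hq]
  simp [S1]

theorem point_edge (p : ℕ) (hp : 3 ≤ p) (hodd : p % 2 = 1) (k j q : ℕ) (hj₁ : p ^ k ≤ j)
    (hj : j < p ^ (k + 1)) (hq : q % 2 = 1) :
    S2 (PhiInf p ((p * q + (p - 1)) * p ^ k) ((p * q + (p - 1)) * p ^ k + j)) := by
  have hP : 0 < p ^ k := by positivity
  apply row_closed p (by omega) S2 (S2_closed p (by omega))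
  have h1 : 1 ≤ j / p ^ k := (Nat.one_le_div_iff hP).2 hj₁
  have h2 : j / p ^ k < p := Nat.div_lt_of_lt_mul (by rwa [pow_succ] at hj)
  obtain ⟨a, ha⟩ : ∃ a, j / p ^ k = a + 1 := ⟨j / p ^ k - 1, by omega⟩
  have : ((p * q + (p - 1)) * p ^ k + j) / p ^ k = a + p * (q + 1) := by
    rw [add_comm, Nat.add_mul_div_right _ _ hP, ha, mul_add]; omega
  rw [this, PhiInf_rec p (by omega), Nat.add_mul_div_left _ _ (by omega : 0 < p),
    Nat.add_mul_mod_self_left, add_comm (p * q), Nat.add_mul_div_left _ _ (by omega : 0 < p),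
    Nat.add_mul_mod_self_left, Nat.div_eq_of_lt (by omega : p - 1 < p),
    Nat.div_eq_of_lt (by omega : a < p), Nat.mod_eq_of_lt (by omega : p - 1 < p),
    Nat.mod_eq_of_lt (by omega : a < p), zero_add, zero_add]
  have h3 : p - 1 ≠ 0 := by omega
  have h4 : a ≠ p - 1 := by omega
  rcases (PhiInf_off p hp hodd q).2 hq with h | h <;> rw [h] <;>
    by_cases h5 : a = 0 <;> simp [Phi, S2, h3, h4, h5, h3.symm]

theorem not_period_one (p : ℕ) (hp : 3 ≤ p) (hodd : p % 2 = 1) (t j : ℕ) (hj : j < p ^ t) :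
    ¬ IsEventualPeriod p j (p ^ t) := by
  rintro ⟨N, hN⟩
  have hP : 0 < p ^ t := by positivity
  have h := hN ((2 * N) * p ^ t) (by nlinarith)
  have h0 := point_even p hp hodd t j (2 * N) hj (by omega)
  have h1 := point_odd p hp hodd t j (2 * N + 1) hj (by omega)
  rw [show (2 * N + 1) * p ^ t = 2 * N * p ^ t + p ^ t by ring, h] at h1
  generalize PhiInf p (2 * N * p ^ t) (2 * N * p ^ t + j) = x at *
  cases x <;> simp [S0, S1] at h0 h1

theorem not_period_small (p : ℕ) (hp : 3 ≤ p) (hodd : p % 2 = 1) (k j : ℕ) (hj₁ : p ^ k ≤ j)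
    (hj : j < p ^ (k + 1)) : ¬ IsEventualPeriod p j (2 * p ^ k) := by
  intro h
  obtain ⟨c, hc⟩ : ∃ c, p = 2 * c + 1 := ⟨p / 2, by omega⟩
  obtain ⟨N, hN⟩ := period_mul h c
  have hP : 0 < p ^ (k + 1) := by positivity
  have h := hN ((2 * N + 1) * p ^ (k + 1)) (by nlinarith)
  have h0 := point_edge p hp hodd k j (2 * N + 1) hj₁ hj (by omega)
  have h1 := point_odd p hp hodd (k + 1) j (2 * N + 1) hj (by omega)
  have e : (p * (2 * N + 1) + (p - 1)) * p ^ k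
      = (2 * N + 1) * p ^ (k + 1) + 2 * p ^ k * c := by
    have : p - 1 = 2 * c := by omega
    rw [this]; ring
  rw [e, h] at h0
  generalize PhiInf p ((2 * N + 1) * p ^ (k + 1)) ((2 * N + 1) * p ^ (k + 1) + j) = x at *
  cases x <;> simp [S1, S2] at h0 h1

/-- For `p^k ≤ j ≤ p^{k+1} − 1`, the `j`-th diagonal of `Φ_p^∞(A)` is
eventually periodic with minimal eventual period exactly `2 p^{k+1}`. -/
theorem phiInf_diagonal_period (p : ℕ) (hp : p.Prime) (hodd : Odd p) (k j : ℕ)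
    (hj₁ : p ^ k ≤ j) (hj₂ : j ≤ p ^ (k + 1) - 1) :
    IsEventualPeriod p j (2 * p ^ (k + 1)) ∧
    ∀ ℓ : ℕ, 1 ≤ ℓ → IsEventualPeriod p j ℓ → 2 * p ^ (k + 1) ≤ ℓ := by
  have hp2 := hp.two_le
  have hod : p % 2 = 1 := Nat.odd_iff.1 hodd
  have hp3 : 3 ≤ p := by omega
  have hP : 0 < p ^ (k + 1) := by positivity
  have hj : j < p ^ (k + 1) := by omega
  have hper := period_two p hp3 hod (k + 1) j hj
  refine ⟨hper, fun l hl h => ?_⟩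
  by_contra hlt
  push Not at hlt
  have hdl : Nat.gcd l (2 * p ^ (k + 1)) ≤ l := Nat.gcd_le_left _ hl
  have hd := period_gcd h hper (by omega)
  obtain ⟨c, hc⟩ := Nat.gcd_dvd_right l (2 * p ^ (k + 1))
  generalize Nat.gcd l (2 * p ^ (k + 1)) = d at *
  have hc1 : c ≠ 1 := by rintro rfl; omega
  have hm := Nat.minFac_prime hc1
  obtain ⟨e, he⟩ := Nat.minFac_dvd c
  have hdv : c.minFac ∣ 2 * p ^ (k + 1) := by
    rw [hc]; exact (Nat.minFac_dvd c).mul_left d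
  rcases (Nat.Prime.dvd_mul hm).1 hdv with h2 | h2
  · have h2 := (Nat.prime_dvd_prime_iff_eq hm Nat.prime_two).1 h2
    rw [h2] at he
    apply not_period_one p hp3 hod (k + 1) j hj
    have : p ^ (k + 1) = d * e := by
      rw [he] at hc
      have : 2 * p ^ (k + 1) = 2 * (d * e) := by rw [hc]; ring
      omega
    rw [this]
    exact period_mul hd e
  · have h2 := (Nat.prime_dvd_prime_iff_eq hm hp).1 (hm.dvd_of_dvd_pow h2)
    rw [h2] at he
    apply not_period_small p hp3 hod k j hj₁ hj
    have : 2 * p ^ k = d * e := by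
      rw [he] at hc
      apply Nat.eq_of_mul_eq_mul_left hp.pos
      calc p * (2 * p ^ k) = 2 * p ^ (k + 1) := by ring
        _ = p * (d * e) := by rw [hc]; ring
    rw [this]
    exact period_mul hd e

end EscapeOfMass
end

section
/- Let p be an odd prime. For every integer n ≥ 2, lim_{k→∞} e_{2p^k, n}(Θ_p) = 2/p; consequently the sequence of diagonals {2p^k}_{k≥0} exhibits exactly 2/p escape of mass, i.e. lim_{n→∞} lim_{k→∞} e_{2p^k, n}(Θ_p) = 2/p. -/
open scoped Classical
open Filter Polynomial

noncomputable section

namespace EscapeOfMass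

variable {K : Type*} [Field K]

/-- The element `t` of `K((t⁻¹))`, modelled as the Laurent series field `K⸨X⸩`
in the variable `X = t⁻¹`; thus `t = X⁻¹ = single (-1) 1`. -/
def tLS (K : Type*) [Field K] : LaurentSeries K := HahnSeries.single (-1 : ℤ) 1

/-- The polynomial part of a Laurent series in `K((t⁻¹))` (the terms with
non-negative powers of `t`, i.e. non-positive powers of `X`). -/
def polyPart (f : LaurentSeries K) : LaurentSeries K :=
  { coeff := fun n => if n ≤ 0 then f.coeff n else 0
    isPWO_support' := by
      refine f.isPWO_support'.mono fun n hn => ?_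
      simp only [Function.mem_support, ne_eq] at hn ⊢
      intro h
      exact hn (by simp [h]) }

/-- The fractional part `⟨f⟩` of a Laurent series in `K((t⁻¹))`. -/
def fracPart (f : LaurentSeries K) : LaurentSeries K := f - polyPart f

/-- The complete quotients of the continued fraction expansion of `f`. -/
def cfQuot (f : LaurentSeries K) : ℕ → LaurentSeries K
  | 0 => f
  | i + 1 => (cfQuot f i - polyPart (cfQuot f i))⁻¹

/-- The partial quotients `A_i` of the continued fraction expansion of `f`. -/
def cfPQ (f : LaurentSeries K) (i : ℕ) : LaurentSeries K := polyPart (cfQuot f i)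

/-- The degree (as an integer) of a Laurent series viewed in `K((t⁻¹))`:
for a nonzero polynomial in `t` this is the usual degree. -/
def degZ (f : LaurentSeries K) : ℤ := -f.order

/-- `f` is a rational Laurent series, i.e. lies in `K(t)`. -/
def IsRatLS (f : LaurentSeries K) : Prop := ∃ r : RatFunc K, (r : LaurentSeries K) = f

/-- `f` is a quadratic irrational: it is irrational and a root of a quadratic
polynomial with coefficients in `K[t]`. -/
def IsQuadIrr (f : LaurentSeries K) : Prop :=
  ¬ IsRatLS f ∧ ∃ a b c : Polynomial K, a ≠ 0 ∧
    Polynomial.aeval (tLS K) a * f ^ 2 + Polynomial.aeval (tLS K) b * f +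
      Polynomial.aeval (tLS K) c = 0

/-- `(m, ℓ)` is a window for the periodic part of the continued fraction of `f`:
the partial quotients are periodic with period `ℓ ≥ 1` from index `m + 1` on. -/
def PeriodWindow (f : LaurentSeries K) (m ℓ : ℕ) : Prop :=
  1 ≤ ℓ ∧ ∀ i : ℕ, m + 1 ≤ i → cfPQ f (i + ℓ) = cfPQ f i

/-- The `n`-escape of mass of the continued fraction expansion of `f`: the proportion,
within one period of the periodic part of the partial quotients of `f`, of the sum
`∑ max (deg A_i - n) 0` relative to `∑ deg A_i`. -/
def eMassOf (f : LaurentSeries K) (n : ℕ) : ℝ :=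
  if h : ∃ s : ℕ × ℕ, PeriodWindow f s.1 s.2 then
    (∑ i ∈ Finset.Ico ((Classical.choose h).1 + 1)
        ((Classical.choose h).1 + 1 + (Classical.choose h).2),
        max ((degZ (cfPQ f i) : ℝ) - n) 0) /
    (∑ i ∈ Finset.Ico ((Classical.choose h).1 + 1)
        ((Classical.choose h).1 + 1 + (Classical.choose h).2),
        (degZ (cfPQ f i) : ℝ))
  else 0

/-- The `n`-escape of mass in the `k`-th diagonal of `f` with respect to the
sequence `{g^k}`. -/
def eMassP (g f : LaurentSeries K) (k n : ℕ) : ℝ := eMassOf (g ^ k * f) n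

/-- The `n`-escape of mass in the `k`-th diagonal of `f` with respect to `{t^k}`. -/
def eMass (f : LaurentSeries K) (k n : ℕ) : ℝ := eMassP (tLS K) f k n

/-- `f` exhibits `c` escape of mass with respect to the sequence `{g^k}`. -/
def ExhibitsEscape (g f : LaurentSeries K) (c : ℝ) : Prop :=
  ∃ L : ℝ, Tendsto (fun n : ℕ => Filter.liminf (fun k : ℕ => eMassP g f k n) atTop)
    atTop (nhds L) ∧ c ≤ L

/-- `f` exhibits exactly `c` escape of mass with respect to the sequence `{g^k}`. -/
def ExhibitsExactEscape (g f : LaurentSeries K) (c : ℝ) : Prop :=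
  Tendsto (fun n : ℕ => Filter.liminf (fun k : ℕ => eMassP g f k n) atTop)
    atTop (nhds c)

/-- `f` exhibits full (`c = 1`) maximal escape of mass with respect to `{g^k}`. -/
def ExhibitsFullMaxEscape (g f : LaurentSeries K) : Prop :=
  Tendsto (fun n : ℕ => Filter.limsup (fun k : ℕ => eMassP g f k n) atTop)
    atTop (nhds 1)

/-- `A ⊆ ℕ` has natural density `c`. -/
def HasDensity (A : Set ℕ) (c : ℝ) : Prop :=
  Tendsto (fun M : ℕ => (((Finset.Icc 1 M).filter fun k => k ∈ A).card : ℝ) / M)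
    atTop (nhds c)

/-- `f` exhibits full generic escape of mass with respect to `{t^k}`. -/
def FullGenericEscape (f : LaurentSeries K) : Prop :=
  ∀ ε : ℝ, 0 < ε → ∃ dens : ℕ → ℝ,
    (∀ n : ℕ, HasDensity {k : ℕ | 1 - ε < eMass f k n} (dens n)) ∧
    Tendsto dens atTop (nhds 1)

/-- Substitution `t ↦ P(t)` on Laurent series: for `f = ∑_{i ≥ d} a_i t^{-i}` (with
`d = f.order` in the variable `X = t⁻¹`), `substLS f P = ∑_{i ≥ d} a_i P(t)^{-i}`. -/
def substLS (f : LaurentSeries K) (P : Polynomial K) : LaurentSeries K :=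
  (Polynomial.aeval (tLS K) P)⁻¹ ^ f.order *
    HahnSeries.ofPowerSeries ℤ K
      (PowerSeries.mk fun n =>
        ∑ j ∈ Finset.range (n + 1),
          f.coeff (f.order + j) * (((Polynomial.aeval (tLS K) P)⁻¹ ^ j).coeff (n : ℤ)))

/-- The `p`-Cantor sequence over `ZMod p`. -/
def cantor (p : ℕ) : ℕ → ZMod p
  | 0 => 1
  | (n + 1) =>
    if hp : 1 < p then
      if (n + 1) % p % 2 = 1 then 0
      else (((p - 1) / 2).choose (((n + 1) % p) / 2) : ZMod p) * cantor p ((n + 1) / p)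
    else 0
  decreasing_by exact Nat.div_lt_self (Nat.succ_pos _) hp

/-- `Θ̃_p = ∑_{i ≥ 0} c_i^{(p)} t^{-i}`. -/
def cantorTilde (p : ℕ) : LaurentSeries (ZMod p) :=
  HahnSeries.ofPowerSeries ℤ (ZMod p) (PowerSeries.mk fun i => cantor p i)

/-- `Θ_p = t⁻¹ ∑_{i ≥ 0} c_i^{(p)} t^{-i}`. -/
def cantorTheta (p : ℕ) : LaurentSeries (ZMod p) :=
  HahnSeries.single (1 : ℤ) 1 * cantorTilde p

/-- The Thue–Morse sequence over `ZMod 2`. -/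
def thueMorse (n : ℕ) : ZMod 2 := ((Nat.digits 2 n).sum : ZMod 2)

/-- The Thue–Morse Laurent series `τ = ∑_{n ≥ 1} τ_n t^{-n}`. -/
def tmSeries : LaurentSeries (ZMod 2) :=
  HahnSeries.ofPowerSeries ℤ (ZMod 2) (PowerSeries.mk fun n => thueMorse n)

/-- The extension of a one-sided sequence to `ℤ` by zero. -/
def extendSeq (S : ℕ → K) : ℤ → K := fun i => if 0 ≤ i then S i.toNat else 0

/-- The entry `W(S)[m, n]` of the number wall of the (doubly infinite) sequence `s`:
the determinant of the `(m+1) × (m+1)` Toeplitz matrix `(s_{n - i + j})`. -/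
def wallEntry (s : ℤ → K) (m : ℕ) (n : ℤ) : K :=
  (Matrix.of fun i j : Fin (m + 1) => s (n - (i : ℕ) + (j : ℕ))).det

/-- The Laurent series `t⁻¹ ∑_{i ≥ 0} s_i t^{-i}` associated to a sequence. -/
def seriesOf (S : ℕ → K) : LaurentSeries K :=
  HahnSeries.single (1 : ℤ) 1 * HahnSeries.ofPowerSeries ℤ K (PowerSeries.mk S)

/-- The coefficient sequence of `Θ = t⁻¹ ∑ s_i t^{-i}`, extended to `ℤ` by zero. -/
def coeffSeq (f : LaurentSeries K) : ℤ → K := fun i => if 0 ≤ i then f.coeff (i + 1) else 0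

/-- The absolute value of a Laurent series in `F_q((t⁻¹))`: `|f| = q^{deg f}`. -/
def absLS {K : Type*} [Field K] [Fintype K] (f : LaurentSeries K) : ℝ :=
  if f = 0 then 0 else (Fintype.card K : ℝ) ^ (-f.order)



lemma order_eq_of {f : LaurentSeries K} {n : ℤ} (h1 : f.coeff n ≠ 0)
    (h2 : ∀ m < n, f.coeff m = 0) : f.order = n := by
  have hf : f ≠ 0 := by rintro rfl; simp at h1
  apply le_antisymm (HahnSeries.order_le_of_coeff_ne_zero h1)
  exact (HahnSeries.le_order_iff_forall hf).2 fun j hj => h2 j hj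

lemma order_inv' {f : LaurentSeries K} (hf : f ≠ 0) : (f⁻¹).order = -f.order := by
  have h := HahnSeries.order_mul hf (inv_ne_zero hf)
  rw [mul_inv_cancel₀ hf, HahnSeries.order_one] at h
  linarith

/-- evaluation of polynomials at `t` -/
abbrev ev (A : K[X]) : LaurentSeries K := Polynomial.aeval (tLS K) A

lemma algebraMap_eq_C (a : K) : algebraMap K (LaurentSeries K) a = HahnSeries.C a := by
  rw [HahnSeries.algebraMap_apply', PowerSeries.algebraMap_apply, HahnSeries.ofPowerSeries_C]
  rfl

lemma coeff_ev (A : K[X]) (n : ℤ) :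
    (ev A).coeff n = if n ≤ 0 then A.coeff (-n).toNat else 0 := by
  induction A using Polynomial.induction_on' with
  | add a b ha hb =>
    simp only [ev, map_add, HahnSeries.coeff_add, Polynomial.coeff_add] at *
    rw [ha, hb]; split_ifs <;> simp
  | monomial i a =>
    simp only [ev, Polynomial.aeval_monomial, tLS, HahnSeries.single_pow, algebraMap_eq_C,
      HahnSeries.C_mul_eq_smul, HahnSeries.coeff_smul, HahnSeries.coeff_single, Polynomial.coeff_monomial, one_pow, smul_eq_mul]
    by_cases h : n ≤ 0
    · simp only [h, if_true]
      by_cases h2 : n = -i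
      · subst h2; simp
      · rw [if_neg (by simpa using h2), if_neg (by omega)]; simp
    · simp only [h, if_false]
      rw [if_neg (by simp; omega)]; simp

lemma coeff_polyPart (f : LaurentSeries K) (n : ℤ) :
    (polyPart f).coeff n = if n ≤ 0 then f.coeff n else 0 := rfl

lemma exists_ev_polyPart (f : LaurentSeries K) : ∃ A : K[X], ev A = polyPart f := by
  refine ⟨∑ i ∈ Finset.range ((-f.order).toNat + 1), Polynomial.monomial i (f.coeff (-i)), ?_⟩
  ext n
  rw [coeff_ev, coeff_polyPart]
  split_ifs with h
  · rw [Polynomial.finsetSum_coeff]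
    simp only [Polynomial.coeff_monomial]
    rw [Finset.sum_ite_eq' (Finset.range _)]
    split_ifs with h2
    · congr 1; omega
    · symm; apply HahnSeries.coeff_eq_zero_of_lt_order
      simp only [Finset.mem_range, not_lt] at h2; omega
  · rfl

lemma order_ev {A : K[X]} (hA : A ≠ 0) : (ev A).order = -(A.natDegree : ℤ) := by
  apply order_eq_of
  · rw [coeff_ev]; simpa using hA
  · intro m hm
    rw [coeff_ev, if_pos (by omega)]
    apply Polynomial.coeff_eq_zero_of_natDegree_lt; omega

lemma ev_inj {A : K[X]} (h : ev A = 0) : A = 0 := by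
  by_contra hA
  have h2 := coeff_ev A (-(A.natDegree : ℤ))
  rw [h] at h2
  simp at h2
  exact hA (Polynomial.leadingCoeff_eq_zero.1 h2.symm)

lemma ev_ne_zero {A : K[X]} (h : A ≠ 0) : ev A ≠ 0 := fun h2 => h (ev_inj h2)

/-- a polynomial in `t` whose coefficients vanish in nonpositive degree is zero -/
lemma ev_eq_zero_of_coeff {A : K[X]} (h : ∀ n ≤ (0 : ℤ), (ev A).coeff n = 0) : A = 0 := by
  ext i
  have := h (-i) (by omega)
  rw [coeff_ev] at this
  simpa using this

/-- all coefficients below `n` vanish -/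
def Vge (f : LaurentSeries K) (n : ℤ) : Prop := ∀ m < n, f.coeff m = 0

lemma Vge.mono {f : LaurentSeries K} {n m : ℤ} (h : Vge f n) (hm : m ≤ n) : Vge f m :=
  fun k hk => h k (by omega)

lemma Vge_zero (n : ℤ) : Vge (0 : LaurentSeries K) n := fun _ _ => by simp

lemma Vge.add {f g : LaurentSeries K} {n : ℤ} (hf : Vge f n) (hg : Vge g n) : Vge (f + g) n :=
  fun k hk => by simp [hf k hk, hg k hk]

lemma Vge.neg {f : LaurentSeries K} {n : ℤ} (hf : Vge f n) : Vge (-f) n :=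
  fun k hk => by simp [hf k hk]

lemma Vge.sub {f g : LaurentSeries K} {n : ℤ} (hf : Vge f n) (hg : Vge g n) : Vge (f - g) n :=
  fun k hk => by simp [hf k hk, hg k hk]

lemma Vge_order (f : LaurentSeries K) : Vge f f.order :=
  fun _ hk => HahnSeries.coeff_eq_zero_of_lt_order hk

lemma Vge.le_order {f : LaurentSeries K} {n : ℤ} (hf : Vge f n) (h0 : f ≠ 0) : n ≤ f.order :=
  (HahnSeries.le_order_iff_forall h0).2 fun j hj => hf j hj

lemma Vge.mul {f g : LaurentSeries K} {n m : ℤ} (hf : Vge f n) (hg : Vge g m) :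
    Vge (f * g) (n + m) := by
  by_cases f0 : f = 0
  · subst f0; rw [zero_mul]; exact Vge_zero _
  by_cases g0 : g = 0
  · subst g0; rw [mul_zero]; exact Vge_zero _
  refine (Vge_order _).mono ?_
  rw [HahnSeries.order_mul f0 g0]
  have := hf.le_order f0
  have := hg.le_order g0
  omega

lemma Vge_ev {A : K[X]} {n : ℕ} (h : A.natDegree ≤ n) : Vge (ev A) (-(n : ℤ)) := by
  intro m hm
  rw [coeff_ev, if_pos (by omega)]
  apply Polynomial.coeff_eq_zero_of_natDegree_lt; omega

lemma ev_eq_zero_of_Vge {A : K[X]} (h : Vge (ev A) 1) : A = 0 :=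
  ev_eq_zero_of_coeff fun n hn => h n (by omega)

lemma natDegree_le_of_Vge {A : K[X]} {n : ℕ} (h : Vge (ev A) (-(n : ℤ))) : A.natDegree ≤ n := by
  by_cases hA : A = 0
  · simp [hA]
  have := h.le_order (ev_ne_zero hA)
  rw [order_ev hA] at this
  omega

lemma Vge_frac (f : LaurentSeries K) : Vge (f - polyPart f) 1 := by
  intro m hm
  simp [coeff_polyPart, show m ≤ 0 by omega]

lemma order_polyPart {f : LaurentSeries K} (h0 : f ≠ 0) (h : f.order ≤ 0) :
    (polyPart f).order = f.order := by
  apply order_eq_of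
  · rw [coeff_polyPart, if_pos h]; simpa [HahnSeries.coeff_order_eq_zero] using h0
  · intro m hm
    rw [coeff_polyPart, HahnSeries.coeff_eq_zero_of_lt_order hm]; simp

/-- invariants of the continued fraction algorithm -/
def Inv (f : LaurentSeries K) (i D : ℕ) : Prop :=
  ∃ Q P Q' P' : K[X], Q ≠ 0 ∧ Q.natDegree = D ∧ (Q' = 0 ∨ Q'.natDegree < D) ∧
    ev Q' * f - ev P' ≠ 0 ∧ (ev Q' * f - ev P').order = D ∧
    ev Q * f - ev P = -(cfQuot f i - polyPart (cfQuot f i)) * (ev Q' * f - ev P')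

lemma Inv_zero (f : LaurentSeries K) : Inv f 0 0 := by
  obtain ⟨A, hA⟩ := exists_ev_polyPart f
  refine ⟨1, A, 0, 1, one_ne_zero, by simp, Or.inl rfl, by simp, ?_, ?_⟩
  · simp [HahnSeries.order_neg]
  · simp only [cfQuot, hA]; simp

/-- `D'` is the degree of the denominator that follows a denominator of degree `D` -/
def Next (f : LaurentSeries K) (D D' : ℕ) : Prop :=
  ∀ Q P : K[X], Q ≠ 0 → Q.natDegree = D → Vge (ev Q * f - ev P) (D + 1) →
    ev Q * f - ev P ≠ 0 ∧ (ev Q * f - ev P).order = D'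

lemma Inv_step {f : LaurentSeries K} {i D D' : ℕ} (h : Inv f i D) (hn : Next f D D') :
    Inv f (i + 1) D' ∧ degZ (cfPQ f (i + 1)) = (D' : ℤ) - D := by
  obtain ⟨Q, P, Q', P', hQ, hQD, hQ', hE', hE'o, hE⟩ := h
  set E := ev Q * f - ev P with hEdef
  set E' := ev Q' * f - ev P' with hE'def
  set z := cfQuot f i - polyPart (cfQuot f i) with hz
  have hzV : Vge z 1 := Vge_frac _
  have hEV : Vge E (D + 1) := by
    rw [hE]
    have := hzV.neg.mul (Vge_order E')
    rw [hE'o] at this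
    exact this.mono (by omega)
  obtain ⟨hE0, hEo⟩ := hn Q P hQ hQD hEV
  have hz0 : z ≠ 0 := by
    intro h0; rw [h0] at hE; simp at hE; exact hE0 hE
  have hzo : z.order = (D' : ℤ) - D := by
    have := HahnSeries.order_mul (neg_ne_zero.2 hz0) hE'
    rw [← hE, hEo, hE'o, HahnSeries.order_neg] at this
    omega
  have hz1 := hzV.le_order hz0
  have hcf : cfQuot f (i + 1) = z⁻¹ := rfl
  have hcfo : (cfQuot f (i + 1)).order = -((D' : ℤ) - D) := by
    rw [hcf, order_inv' hz0, hzo]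
  have hcf0 : cfQuot f (i + 1) ≠ 0 := by rw [hcf]; exact inv_ne_zero hz0
  have hpo := order_polyPart hcf0 (by rw [hcfo]; omega)
  obtain ⟨A, hA⟩ := exists_ev_polyPart (cfQuot f (i + 1))
  have hdeg : degZ (cfPQ f (i + 1)) = (D' : ℤ) - D := by
    rw [degZ, cfPQ, hpo, hcfo]; ring
  refine ⟨?_, hdeg⟩
  have hA0 : A ≠ 0 := by
    rintro rfl
    rw [← hA] at hpo
    simp [ev] at hpo
    omega
  have hAd : (A.natDegree : ℤ) = D' - D := by
    have := order_ev hA0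
    rw [hA, hpo, hcfo] at this; omega
  have hAQd : (A * Q).natDegree = D' := by
    rw [Polynomial.natDegree_mul hA0 hQ]; omega
  have hlt : Q'.degree < (A * Q).degree := by
    rw [Polynomial.degree_eq_natDegree (mul_ne_zero hA0 hQ), hAQd]
    rcases hQ' with h | h
    · rw [h, Polynomial.degree_zero]; exact WithBot.bot_lt_coe _
    · refine lt_of_le_of_lt Polynomial.degree_le_natDegree ?_
      exact_mod_cast (by omega : Q'.natDegree < D')
  refine ⟨A * Q + Q', A * P + P', Q, P, ?_, ?_, ?_, hE0, hEo, ?_⟩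
  · intro h0
    have := Polynomial.degree_add_eq_left_of_degree_lt hlt
    rw [h0, Polynomial.degree_zero] at this
    exact mul_ne_zero hA0 hQ (Polynomial.degree_eq_bot.1 this.symm)
  · rw [Polynomial.natDegree_add_eq_left_of_degree_lt hlt, hAQd]
  · right; omega
  · have h1 : ev (A * Q + Q') * f - ev (A * P + P') = ev A * E + E' := by
      simp only [ev, map_add, map_mul, hEdef, hE'def]; ring
    have h2 : E' = -(cfQuot f (i + 1)) * E := by
      rw [hE, hcf]; field_simp
    rw [h1, ← hA]
    change ev A * E + E' = -(cfQuot f (i + 1) - ev A) * E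
    rw [h2]; ring

lemma Next_of_explicit {f : LaurentSeries K} {D D' : ℕ} (hDD : D < D') (Q P : K[X]) (hQ : Q ≠ 0)
    (hQD : Q.natDegree = D) (hE : ev Q * f - ev P ≠ 0) (hEo : (ev Q * f - ev P).order = D') :
    Next f D D' := by
  intro R S hR hRD hV
  have h1 : ev (R * P - Q * S) = ev Q * (ev R * f - ev S) - ev R * (ev Q * f - ev P) := by
    simp only [ev, map_sub, map_mul]; ring
  have h2 : R * P - Q * S = 0 := by
    apply ev_eq_zero_of_Vge
    rw [h1]
    have a := (Vge_ev hQD.le).mul hV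
    have b := (Vge_ev hRD.le).mul (Vge_order (ev Q * f - ev P))
    rw [hEo] at b
    exact (a.mono (by omega)).sub (b.mono (by omega))
  rw [h2] at h1
  have h3 : ev Q * (ev R * f - ev S) = ev R * (ev Q * f - ev P) := by
    rw [← sub_eq_zero, ← h1]; simp [ev]
  have h4 : ev R * f - ev S ≠ 0 := by
    intro h0
    rw [h0, mul_zero] at h3
    exact mul_ne_zero (ev_ne_zero hR) hE h3.symm
  refine ⟨h4, ?_⟩
  have h5 := congrArg HahnSeries.order h3
  rw [HahnSeries.order_mul (ev_ne_zero hQ) h4, HahnSeries.order_mul (ev_ne_zero hR) hE,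
    order_ev hQ, order_ev hR, hRD, hQD, hEo] at h5
  omega

lemma Next_of_regular {f : LaurentSeries K} {D : ℕ}
    (h : ∀ Q P : K[X], Q.natDegree ≤ D → Vge (ev Q * f - ev P) (D + 2) → Q = 0) :
    Next f D (D + 1) := by
  intro Q P hQ hQD hV
  have hc : (ev Q * f - ev P).coeff (D + 1) ≠ 0 := by
    intro h0
    apply hQ
    apply h Q P hQD.le
    intro m hm
    rcases lt_or_eq_of_le (show m ≤ D + 1 by omega) with h1 | h1
    · exact hV m h1
    · rw [h1, h0]
  refine ⟨fun h0 => by simp [h0] at hc, ?_⟩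
  push_cast
  exact order_eq_of hc hV

lemma cantor_mul_add (p : ℕ) (hp : 1 < p) (m i : ℕ) (hi : i < p) :
    cantor p (p * m + i) =
      if i % 2 = 1 then 0 else (((p - 1) / 2).choose (i / 2) : ZMod p) * cantor p m := by
  rcases hn : p * m + i with _ | n
  · have hm : m = 0 := by
      rcases Nat.eq_zero_or_pos m with h | h
      · exact h
      · have := Nat.mul_pos (by omega : 0 < p) h; omega
    have hi0 : i = 0 := by omega
    subst hm; subst hi0; simp [cantor]
  · rw [cantor, dif_pos hp, ← hn, Nat.mul_add_mod, Nat.mod_eq_of_lt hi,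
      Nat.mul_add_div (by omega), Nat.div_eq_of_lt hi, add_zero]

/-- the power series of the Cantor sequence -/
def cps (p : ℕ) : PowerSeries (ZMod p) := PowerSeries.mk fun i => cantor p i

lemma cps_pow (p : ℕ) [Fact p.Prime] (m r : ℕ) (hr : r < p) :
    PowerSeries.coeff (p * m + r) (cps p ^ p) = if r = 0 then cantor p m else 0 := by
  have hp := (Fact.out : p.Prime)
  have h1 : PowerSeries.coeff (p * m + r) (cps p ^ p) =
      PowerSeries.coeff (p * m + r) (((PowerSeries.trunc (p * m + r + 1) (cps p) : (ZMod p)[X]) :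
        PowerSeries (ZMod p)) ^ p) := by
    have h0 := congrArg (fun g => Polynomial.coeff g (p * m + r))
      (PowerSeries.trunc_trunc_pow (cps p) (p * m + r + 1) p)
    simp only [PowerSeries.coeff_trunc] at h0
    rw [if_pos (by omega), if_pos (by omega)] at h0
    exact h0.symm
  rw [h1, ← Polynomial.coe_pow, Polynomial.coeff_coe, ← ZMod.expand_card,
    Polynomial.coeff_expand hp.pos]
  by_cases h : r = 0
  · subst h
    have : m < p * m + 0 + 1 := by nlinarith [hp.pos]
    simp [PowerSeries.coeff_trunc, cps, Nat.mul_div_cancel_left _ hp.pos]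
    intro h2; omega
  · rw [if_neg, if_neg h]
    intro h2
    rw [Nat.dvd_add_right (Dvd.intro _ rfl)] at h2
    exact h (Nat.eq_zero_of_dvd_of_lt h2 hr)

lemma cps_eq (p : ℕ) [Fact p.Prime] (hodd : Odd p) :
    cps p = (1 + PowerSeries.X ^ 2) ^ ((p - 1) / 2) * cps p ^ p := by
  have hp := (Fact.out : p.Prime)
  obtain ⟨r, hr⟩ := hodd
  have hr' : (p - 1) / 2 = r := by omega
  rw [hr']
  ext n
  obtain ⟨m, i, hi, rfl⟩ : ∃ m i, i < p ∧ n = p * m + i :=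
    ⟨n / p, n % p, Nat.mod_lt _ hp.pos, (Nat.div_add_mod n p).symm⟩
  rw [cps, PowerSeries.coeff_mk, ← cps, cantor_mul_add p hp.one_lt m i hi, hr', add_comm (1 : PowerSeries (ZMod p)), add_pow,
    Finset.sum_mul, map_sum]
  have key : ∀ k ∈ Finset.range (r + 1),
      PowerSeries.coeff (p * m + i) ((PowerSeries.X ^ 2) ^ k * 1 ^ (r - k) * (r.choose k : PowerSeries (ZMod p)) * cps p ^ p)
        = if i = 2 * k then (r.choose k : ZMod p) * cantor p m else 0 := by
    intro k hk
    simp only [Finset.mem_range] at hk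
    have e1 : (PowerSeries.X ^ 2) ^ k * 1 ^ (r - k) * (r.choose k : PowerSeries (ZMod p)) * cps p ^ p
        = PowerSeries.C (r.choose k : ZMod p) * (PowerSeries.X ^ (2 * k) * cps p ^ p) := by
      rw [map_natCast]; ring
    rw [e1, PowerSeries.coeff_C_mul, PowerSeries.coeff_X_pow_mul']
    by_cases h1 : 2 * k ≤ i
    · rw [if_pos (by omega), show p * m + i - 2 * k = p * m + (i - 2 * k) by omega,
        cps_pow p m _ (by omega)]
      by_cases h2 : i = 2 * k
      · rw [if_pos (by omega), if_pos h2]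
      · rw [if_neg (by omega), if_neg h2, mul_zero]
    · rw [if_neg (show ¬ i = 2 * k by omega)]
      split_ifs with h3
      · rcases m with _ | m
        · omega
        · rw [show p * (m + 1) + i - 2 * k = p * m + (p + i - 2 * k) by
            rw [Nat.mul_succ]; omega, cps_pow p m _ (by omega), if_neg (by omega), mul_zero]
      · rw [mul_zero]
  rw [Finset.sum_congr rfl key]
  split_ifs with h
  · symm; apply Finset.sum_eq_zero
    intro k hk; rw [if_neg (by omega)]
  · rw [Finset.sum_eq_single (i / 2)]
    · rw [if_pos (by omega)]
    · intro k _ hk; rw [if_neg (by omega)]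
    · intro hk; simp only [Finset.mem_range] at hk; omega

lemma cps_sq (p : ℕ) [Fact p.Prime] (hodd : Odd p) :
    (1 + PowerSeries.X ^ 2) * cps p ^ 2 = 1 := by
  have hp := (Fact.out : p.Prime)
  have h := cps_eq p hodd
  obtain ⟨r, hr⟩ := hodd
  have hr' : (p - 1) / 2 = r := by omega
  rw [hr'] at h
  have hc : PowerSeries.constantCoeff (cps p) = 1 := by
    rw [← PowerSeries.coeff_zero_eq_constantCoeff_apply, cps, PowerSeries.coeff_mk, cantor]
  have h0 : cps p ≠ 0 := by
    intro h0; rw [h0] at hc; simp at hc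
  set w := (1 + PowerSeries.X ^ 2) * cps p ^ 2 with hw
  have h1 : w ^ r = 1 := by
    have : cps p * w ^ r = cps p * 1 := by
      rw [mul_one]
      conv_rhs => rw [h]
      rw [hw, mul_pow, ← pow_mul]
      have e : cps p ^ p = cps p ^ (2 * r + 1) := congrArg (fun k => cps p ^ k) hr
      rw [e]
      ring
    exact mul_left_cancel₀ h0 this
  have hcw : PowerSeries.constantCoeff w = 1 := by simp [hw, hc]
  have h2 : (w - 1) * ∑ i ∈ Finset.range r, w ^ i = 0 := by
    rw [mul_comm, geom_sum_mul, h1, sub_self]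
  rcases mul_eq_zero.1 h2 with h3 | h3
  · exact sub_eq_zero.1 h3
  · exfalso
    have := congrArg PowerSeries.constantCoeff h3
    simp [hcw] at this
    rw [ZMod.natCast_eq_zero_iff] at this
    have hr0 : r ≠ 0 := by rintro rfl; simp at hr; exact hp.one_lt.ne' hr
    have := Nat.le_of_dvd (by omega) this
    omega

lemma theta_sq (p : ℕ) [Fact p.Prime] (hodd : Odd p) :
    (tLS (ZMod p) ^ 2 + 1) * cantorTheta p ^ 2 = 1 := by
  have h := congrArg (HahnSeries.ofPowerSeries ℤ (ZMod p)) (cps_sq p hodd)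
  simp only [map_mul, map_add, map_pow, map_one, HahnSeries.ofPowerSeries_X] at h
  have ht : tLS (ZMod p) * HahnSeries.single (1 : ℤ) 1 = 1 := by
    simp [tLS]
  have e : cantorTheta p = HahnSeries.single (1 : ℤ) 1 * HahnSeries.ofPowerSeries ℤ (ZMod p) (cps p) := rfl
  rw [e]
  linear_combination h + (tLS (ZMod p) * HahnSeries.single (1 : ℤ) 1 + 1) * (HahnSeries.ofPowerSeries ℤ (ZMod p) (cps p)) ^ 2 * ht

lemma theta_order (p : ℕ) [Fact p.Prime] : (cantorTheta p).order = 1 := by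
  have e : cantorTheta p = HahnSeries.single (1 : ℤ) 1 * HahnSeries.ofPowerSeries ℤ (ZMod p) (cps p) := rfl
  have hc : (HahnSeries.ofPowerSeries ℤ (ZMod p) (cps p)).coeff 0 = 1 := by
    have := HahnSeries.ofPowerSeries_apply_coeff (Γ := ℤ) (cps p) 0
    simp only [Nat.cast_zero] at this
    rw [this, cps, PowerSeries.coeff_mk, cantor]
  have ho : (HahnSeries.ofPowerSeries ℤ (ZMod p) (cps p)).order = 0 := by
    apply order_eq_of
    · rw [hc]; exact one_ne_zero
    · intro m hm
      rw [HahnSeries.ofPowerSeries_apply, HahnSeries.embDomain_of_notMem_range]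
      rintro ⟨k, hk⟩
      simp at hk
      omega
  have h0 : HahnSeries.ofPowerSeries ℤ (ZMod p) (cps p) ≠ 0 := by
    intro h; rw [h] at hc; simp at hc
  rw [e, HahnSeries.order_mul (by simp) h0, ho, HahnSeries.order_single one_ne_zero]; rfl

lemma theta_ne_zero (p : ℕ) [Fact p.Prime] : cantorTheta p ≠ 0 := by
  intro h; have := theta_order p; rw [h] at this; simp at this

lemma seq_zero (h2K : (2 : K) ≠ 0) (q c : ℕ) (ρ h : ℤ) (hρ0 : 0 ≤ ρ) (hρ : ρ < q)
    (hh : h = q * c + ρ + 1) (g : ℤ → K)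
    (hsupp : ∀ j, h ≤ |j| → g j = 0)
    (hrec : ∀ j, |j| < h → g (j - 2 * q) - 2 * g j + g (j + 2 * q) = 0)
    (hc1 : (c + 1 : K) ≠ 0)
    (hc2 : (c + 2 : K) ≠ 0 ∨ (ρ = 0 ∧ (c + 2 : K) = 0 ∧ g (-(h - 1)) = g (h - 1))) :
    ∀ j, g j = 0 := by
  intro j
  by_cases hj : h ≤ |j|
  · exact hsupp j hj
  rw [not_le, abs_lt] at hj
  have hqc : (0 : ℤ) ≤ (q : ℤ) * c := by positivity
  have hq : (0 : ℤ) < q := by omega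
  -- starting point of the progression
  obtain ⟨j0, k0, hj0a, hj0b, hjk⟩ : ∃ (j0 : ℤ) (k0 : ℕ), j0 ≤ -h ∧ -h < j0 + 2 * q ∧
      j = j0 + 2 * q * k0 := by
    refine ⟨-h - ((-h - j) % (2 * q)), (-((-h - j) / (2 * q))).toNat, ?_, ?_, ?_⟩
    · have := Int.emod_nonneg (-h - j) (show (2 * q : ℤ) ≠ 0 by omega); omega
    · have := Int.emod_lt_of_pos (-h - j) (show (0 : ℤ) < 2 * q by omega); omega
    · have h1 : (-h - j) / (2 * q) ≤ 0 := by
        apply Int.ediv_nonpos_of_nonpos_of_neg <;> omega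
      have h2 := Int.mul_ediv_add_emod (-h - j) (2 * q)
      rw [Int.toNat_of_nonneg (by omega)]
      linarith
  have P : ∀ k : ℕ, j0 + 2 * q * k < h → g (j0 + 2 * q * k) = k * g (j0 + 2 * q) ∧
      g (j0 + 2 * q * (k + 1)) = (k + 1) * g (j0 + 2 * q) := by
    intro k
    induction k with
    | zero =>
      intro _
      simp only [Nat.cast_zero, mul_zero, add_zero, zero_mul, zero_add, mul_one, one_mul, and_true]
      apply hsupp
      rw [le_abs]; right; omega
    | succ k ih =>
      intro hk
      push_cast at hk ⊢
      have e1 : 2 * (q : ℤ) * (k + 1) = 2 * q * k + 2 * q := by ring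
      have hk0 : (0 : ℤ) ≤ 2 * q * k := by positivity
      obtain ⟨i1, i2⟩ := ih (by omega)
      have hr := hrec (j0 + 2 * q * (k + 1)) (by rw [abs_lt]; constructor <;> omega)
      rw [show j0 + 2 * (q : ℤ) * (k + 1) - 2 * q = j0 + 2 * q * k by ring,
        show j0 + 2 * (q : ℤ) * (k + 1) + 2 * q = j0 + 2 * q * (k + 1 + 1) by ring, i1, i2] at hr
      refine ⟨i2, ?_⟩
      linear_combination hr
  have hG1 : g (j0 + 2 * q) = 0 := by
    have e1 : 2 * (q : ℤ) * c = 2 * (q * c) := by ring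
    have e2 : 2 * (q : ℤ) * (c + 1) = 2 * (q * c) + 2 * q := by ring
    have e3 : 2 * (q : ℤ) * (c + 1 + 1) = 2 * (q * c) + 4 * q := by ring
    have p1 := (P c (by rw [e1]; omega)).2
    by_cases hcase : h ≤ j0 + 2 * q * (c + 1)
    · rw [hsupp _ (by rw [le_abs]; left; exact hcase)] at p1
      exact (mul_eq_zero.1 p1.symm).resolve_left hc1
    · have p2 := (P (c + 1) (by push_cast; omega)).2
      push_cast at p2
      rw [hsupp _ (by rw [le_abs]; left; rw [e3]; omega)] at p2
      rcases hc2 with hc2 | ⟨hρ1, hc3, hs⟩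
      · refine (mul_eq_zero.1 p2.symm).resolve_left ?_
        rwa [add_assoc, one_add_one_eq_two]
      · have hj0 : j0 = -h - 2 * q + 1 := by omega
        rw [show j0 + 2 * (q : ℤ) * (c + 1) = h - 1 by rw [e2]; omega, ← hs,
          show -(h - 1) = j0 + 2 * q by omega] at p1
        have : (2 : K) * g (j0 + 2 * q) = 0 := by linear_combination p1 + g (j0 + 2 * q) * hc3
        exact (mul_eq_zero.1 this).resolve_left h2K
  rcases Nat.eq_zero_or_pos k0 with hk | hk
  · rw [hjk, hk]; simp
    apply hsupp
    rw [le_abs]; right; omega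
  · rw [hjk, (P k0 (by omega)).1, hG1, mul_zero]

lemma sum_range_mul_periodic (F : ℕ → ℝ) (a l : ℕ) (h : ∀ i, a ≤ i → F (i + l) = F i) (n : ℕ) :
    ∑ i ∈ Finset.range (l * n), F (a + i) = n * ∑ i ∈ Finset.range l, F (a + i) := by
  have hs : ∀ n i, a ≤ i → F (i + l * n) = F i := by
    intro n
    induction n with
    | zero => intro i _; simp
    | succ n ih => intro i hi; rw [Nat.mul_succ, ← add_assoc, h _ (by omega), ih i hi]
  induction n with
  | zero => simp
  | succ n ih =>
    rw [Nat.mul_succ, Finset.sum_range_add, ih]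
    have : ∀ x ∈ Finset.range l, F (a + (l * n + x)) = F (a + x) := by
      intro x _
      rw [show a + (l * n + x) = (a + x) + l * n by ring]
      exact hs n _ (by omega)
    rw [Finset.sum_congr rfl this]
    push_cast; ring

lemma sum_range_shift (F : ℕ → ℝ) (l : ℕ) (h : ∀ i, 1 ≤ i → F (i + l) = F i) (m : ℕ) :
    ∑ i ∈ Finset.range l, F (m + 1 + i) = ∑ i ∈ Finset.range l, F (1 + i) := by
  induction m with
  | zero => simp
  | succ m ih =>
    rw [← ih]
    have h1 := Finset.sum_range_succ (fun i => F (m + 1 + i)) l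
    have h2 := Finset.sum_range_succ' (fun i => F (m + 1 + i)) l
    have h3 := h (m + 1) (by omega)
    simp only [add_zero] at h2
    have h4 : ∑ i ∈ Finset.range l, F (m + 1 + 1 + i) = ∑ i ∈ Finset.range l, F (m + 1 + (i + 1)) := by
      apply Finset.sum_congr rfl; intro i _; congr 1; ring
    rw [h4]; linarith

/-- sum over an arbitrary period window compared with a known period -/
lemma window_sum (F : ℕ → ℝ) (m l N : ℕ) (hl : ∀ i, m + 1 ≤ i → F (i + l) = F i)
    (hN : ∀ i, 1 ≤ i → F (i + N) = F i) :
    N * ∑ i ∈ Finset.Ico (m + 1) (m + 1 + l), F i = l * ∑ i ∈ Finset.range N, F (1 + i) := by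
  rw [Finset.sum_Ico_eq_sum_range, Nat.add_sub_cancel_left, ← sum_range_shift F N hN m,
    ← sum_range_mul_periodic F (m + 1) l hl, ← sum_range_mul_periodic F (m + 1) N
      (fun i hi => hN i (by omega)), mul_comm]

/-- the degrees of the partial quotients -/
def dg (B q i : ℕ) : ℕ := if B ∣ i then (if Odd (i / B) then 2 * q + 1 else 2 * q - 1) else 1

lemma dg_periodic (B q i : ℕ) (hB : 0 < B) : dg B q (i + 2 * B) = dg B q i := by
  unfold dg
  have h1 : B ∣ i + 2 * B ↔ B ∣ i := by
    rw [Nat.dvd_add_left (Dvd.intro_left _ rfl)]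
  have h2 : (i + 2 * B) / B = i / B + 2 := by
    rw [mul_comm, Nat.add_mul_div_left _ _ hB]
  simp only [h1, h2, Nat.odd_add, even_two, iff_true]

lemma sum_dg (φ : ℕ → ℝ) (B q : ℕ) (hB : 0 < B) :
    ∑ i ∈ Finset.range (2 * B), φ (dg B q (1 + i)) =
      2 * (B - 1 : ℝ) * φ 1 + φ (2 * q + 1) + φ (2 * q - 1) := by
  obtain ⟨b, rfl⟩ : ∃ b, B = b + 1 := ⟨B - 1, by omega⟩
  rw [show 2 * (b + 1) = (b + 1) + (b + 1) by ring, Finset.sum_range_add, Finset.sum_range_succ,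
    Finset.sum_range_succ]
  have e1 : dg (b + 1) q (1 + b) = 2 * q + 1 := by
    unfold dg; rw [add_comm 1 b, if_pos dvd_rfl, Nat.div_self (by omega), if_pos odd_one]
  have e2 : dg (b + 1) q (1 + (b + 1 + b)) = 2 * q - 1 := by
    unfold dg
    rw [show 1 + (b + 1 + b) = (b + 1) * 2 by ring, if_pos (Dvd.intro _ rfl),
      Nat.mul_div_cancel_left _ (by omega), if_neg (by decide)]
  have e3 : ∀ i ∈ Finset.range b, φ (dg (b + 1) q (1 + i)) = φ 1 := by
    intro i hi
    simp only [Finset.mem_range] at hi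
    unfold dg
    rw [if_neg]
    intro h; have := Nat.le_of_dvd (by omega) h; omega
  have e4 : ∀ i ∈ Finset.range b, φ (dg (b + 1) q (1 + (b + 1 + i))) = φ 1 := by
    intro i hi
    simp only [Finset.mem_range] at hi
    unfold dg
    rw [if_neg]
    intro h
    rw [show 1 + (b + 1 + i) = (b + 1) + (1 + i) by ring, Nat.dvd_add_right dvd_rfl] at h
    have := Nat.le_of_dvd (by omega) h; omega
  rw [Finset.sum_congr rfl e3, Finset.sum_congr rfl e4, e1, e2]
  simp; ring

lemma eMassOf_eq (f : LaurentSeries K) (B q n : ℕ) (hB : 0 < B) (hn : 2 ≤ n) (hq : n < q)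
    (hper : ∃ s : ℕ × ℕ, PeriodWindow f s.1 s.2)
    (hd : ∀ i, 1 ≤ i → degZ (cfPQ f i) = dg B q i) :
    eMassOf f n = (4 * q - 2 * n) / (2 * (B - 1) + 4 * q) := by
  rw [eMassOf, dif_pos hper]
  set s := Classical.choose hper with hs
  obtain ⟨hl, hw⟩ := Classical.choose_spec hper
  rw [← hs] at hl hw
  set m := s.1
  set l := s.2
  have key : ∀ φ : ℕ → ℝ, (2 * B : ℕ) * ∑ i ∈ Finset.Ico (m + 1) (m + 1 + l), φ (dg B q i)
      = l * (2 * (B - 1 : ℝ) * φ 1 + φ (2 * q + 1) + φ (2 * q - 1)) := by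
    intro φ
    rw [← sum_dg φ B q hB]
    apply window_sum (fun i => φ (dg B q i))
    · intro i hi
      have h1 := hd i (by omega)
      have h2 := hd (i + l) (by omega)
      rw [hw i hi, h1] at h2
      have h3 : dg B q i = dg B q (i + l) := by exact_mod_cast h2
      simp only [h3]
    · intro i _
      simp only [dg_periodic B q i hB]
  have e1 : ∑ i ∈ Finset.Ico (m + 1) (m + 1 + l), max ((degZ (cfPQ f i) : ℝ) - n) 0
      = ∑ i ∈ Finset.Ico (m + 1) (m + 1 + l), (fun d : ℕ => max ((d : ℝ) - n) 0) (dg B q i) := by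
    apply Finset.sum_congr rfl
    intro i hi
    rw [hd i (by simp at hi; omega)]; simp
  have e2 : ∑ i ∈ Finset.Ico (m + 1) (m + 1 + l), (degZ (cfPQ f i) : ℝ)
      = ∑ i ∈ Finset.Ico (m + 1) (m + 1 + l), (fun d : ℕ => (d : ℝ)) (dg B q i) := by
    apply Finset.sum_congr rfl
    intro i hi
    rw [hd i (by simp at hi; omega)]; simp
  rw [e1, e2]
  have k1 := key (fun d : ℕ => max ((d : ℝ) - n) 0)
  have k2 := key (fun d : ℕ => (d : ℝ))
  have hn' : (2 : ℝ) ≤ n := by exact_mod_cast hn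
  have hq' : (n : ℝ) + 1 ≤ q := by exact_mod_cast hq
  have c1 : ((2 * q - 1 : ℕ) : ℝ) = 2 * q - 1 := by
    rw [Nat.cast_sub (by omega)]; push_cast; ring
  simp only [c1] at k1 k2
  push_cast at k1 k2
  rw [max_eq_right (by linarith), max_eq_left (by linarith), max_eq_left (by linarith)] at k1
  have hB' : (0 : ℝ) < B := by exact_mod_cast hB
  have hB1 : (1 : ℝ) ≤ B := by exact_mod_cast hB
  have hl' : (0 : ℝ) < l := by exact_mod_cast hl
  set S1 := ∑ i ∈ Finset.Ico (m + 1) (m + 1 + l), (fun d : ℕ => max ((d : ℝ) - n) 0) (dg B q i)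
  set S2 := ∑ i ∈ Finset.Ico (m + 1) (m + 1 + l), (fun d : ℕ => (d : ℝ)) (dg B q i)
  have s1 : S1 = l * (4 * q - 2 * n) / (2 * B) := by
    rw [eq_div_iff (by positivity)]; linarith
  have s2 : S2 = l * (2 * (B - 1) + 4 * q) / (2 * B) := by
    rw [eq_div_iff (by positivity)]; linarith
  have : (0 : ℝ) < 2 * (B - 1) + 4 * q := by linarith
  rw [s1, s2]
  field_simp

abbrev LP (K : Type*) [Field K] := LaurentPolynomial K

/-- the hyperelliptic substitution -/
def phi (K : Type*) [Field K] : K[X] →ₐ[K] LP K :=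
  aeval (LaurentPolynomial.C (2⁻¹ : K) * (LaurentPolynomial.T 1 - LaurentPolynomial.T (-1)))

def psi (u : (LaurentSeries K)ˣ) : LP K →+* LaurentSeries K :=
  LaurentPolynomial.eval₂ (HahnSeries.C : K →+* LaurentSeries K) u

lemma phi_X : phi K X =
    LaurentPolynomial.C (2⁻¹ : K) * (LaurentPolynomial.T 1 - LaurentPolynomial.T (-1)) := by
  simp [phi]

lemma phi_C (a : K) : phi K (Polynomial.C a) = LaurentPolynomial.C a := by
  rw [phi, aeval_C, LaurentPolynomial.C_eq_algebraMap]

def tauU (K : Type*) [Field K] : (LP K)ˣ where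
  val := -LaurentPolynomial.T (-1)
  inv := -LaurentPolynomial.T 1
  val_inv := by rw [neg_mul_neg, ← LaurentPolynomial.T_add]; rfl
  inv_val := by rw [neg_mul_neg, ← LaurentPolynomial.T_add]; rfl

def sig (K : Type*) [Field K] : LP K →+* LP K :=
  LaurentPolynomial.eval₂ (LaurentPolynomial.C : K →+* LP K) (tauU K)

lemma tauU_zpow (n : ℤ) : ((tauU K ^ n : (LP K)ˣ) : LP K) =
    LaurentPolynomial.C ((-1 : K) ^ n) * LaurentPolynomial.T (-n) := by
  induction n using Int.induction_on with
  | zero => simp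
  | succ n ih =>
    rw [zpow_add_one, Units.val_mul, ih, zpow_add_one₀ (by simp), neg_add, LaurentPolynomial.T_add]
    have : (tauU K).val = -LaurentPolynomial.T (-1) := rfl
    rw [this, map_mul, map_neg, map_one]; ring
  | pred n ih =>
    rw [zpow_sub_one, Units.val_mul, ih, zpow_sub_one₀ (by simp),
      show -(-(n : ℤ) - 1) = - -(n:ℤ) + 1 by ring, LaurentPolynomial.T_add]
    have : ((tauU K)⁻¹ : (LP K)ˣ).val = -LaurentPolynomial.T 1 := rfl
    rw [this, map_mul, inv_neg, inv_one, map_neg, map_one]; ring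

lemma sig_coeff (g : LP K) (j : ℤ) : (sig K g).coeff j = (-1) ^ j * g.coeff (-j) := by
  induction g using LaurentPolynomial.induction_on' with
  | add a b ha hb => 
    rw [map_add, AddMonoidAlgebra.coeff_add, AddMonoidAlgebra.coeff_add, Finsupp.add_apply,
      Finsupp.add_apply, ha, hb]; ring
  | C_mul_T n a =>
    rw [sig, LaurentPolynomial.eval₂_C_mul_T, tauU_zpow, ← mul_assoc, ← map_mul,
      ← LaurentPolynomial.single_eq_C_mul_T, ← LaurentPolynomial.single_eq_C_mul_T,
      AddMonoidAlgebra.coeff_single, AddMonoidAlgebra.coeff_single]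
    by_cases h : n = -j
    · subst h
      simp only [neg_neg, Finsupp.single_eq_same, zpow_neg]
      rw [← inv_zpow, inv_neg, inv_one, mul_comm]
    · rw [Finsupp.single_eq_of_ne (by omega), Finsupp.single_eq_of_ne (by omega)]; simp

lemma sig_C (a : K) : sig K (LaurentPolynomial.C a) = LaurentPolynomial.C a := by
  simp [sig]

lemma sig_T1 : sig K (LaurentPolynomial.T 1) = -LaurentPolynomial.T (-1) := by
  simp [sig, tauU]

lemma sig_Tm1 : sig K (LaurentPolynomial.T (-1)) = -LaurentPolynomial.T 1 := by
  rw [sig, LaurentPolynomial.eval₂_T, tauU_zpow]; simp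

lemma sig_phi (A : K[X]) : sig K (phi K A) = phi K A := by
  have : (sig K).comp (phi K : K[X] →+* LP K) = (phi K : K[X] →+* LP K) := by
    apply Polynomial.ringHom_ext
    · intro a
      simp only [RingHom.comp_apply, RingHom.coe_coe, phi_C, sig_C]
    · simp only [RingHom.comp_apply, RingHom.coe_coe, phi_X, map_mul, map_sub, sig_C, sig_T1, sig_Tm1]
      ring
  exact DFunLike.congr_fun this A

lemma psi_T1 (u : (LaurentSeries K)ˣ) : psi u (LaurentPolynomial.T 1) = u := by
  simp [psi]

lemma psi_Tm1 (u : (LaurentSeries K)ˣ) : psi u (LaurentPolynomial.T (-1)) = (u : LaurentSeries K)⁻¹ := by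
  simp [psi]

lemma psi_C (u : (LaurentSeries K)ˣ) (a : K) : psi u (LaurentPolynomial.C a) = HahnSeries.C a := by
  simp [psi]

lemma psi_phi (h2K : (2 : K) ≠ 0) (u : (LaurentSeries K)ˣ)
    (hu : (u : LaurentSeries K) - (u : LaurentSeries K)⁻¹ = 2 * tLS K) (A : K[X]) :
    psi u (phi K A) = ev A := by
  have : (psi u).comp (phi K : K[X] →+* LP K) = (aeval (tLS K) : K[X] →ₐ[K] _).toRingHom := by
    apply Polynomial.ringHom_ext
    · intro a
      simp only [RingHom.comp_apply, RingHom.coe_coe, phi_C, psi_C]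
      simp [algebraMap_eq_C]
    · simp only [RingHom.comp_apply, RingHom.coe_coe, phi_X, map_mul, map_sub, psi_C, psi_T1, psi_Tm1, hu]
      have : (2 : LaurentSeries K) = HahnSeries.C (2:K) := (map_ofNat _ 2).symm
      rw [this, ← mul_assoc, ← map_mul, inv_mul_cancel₀ h2K]
      simp
  exact DFunLike.congr_fun this A

lemma order_zpow' {u : LaurentSeries K} (hu : u ≠ 0) (n : ℤ) : (u ^ n).order = n * u.order := by
  induction n using Int.induction_on with
  | zero => simp
  | succ n ih =>
    rw [zpow_add_one₀ hu, HahnSeries.order_mul (zpow_ne_zero _ hu) hu, ih]; ring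
  | pred n ih =>
    rw [zpow_sub_one₀ hu, HahnSeries.order_mul (zpow_ne_zero _ hu) (inv_ne_zero hu), ih,
      order_inv' hu]; ring

lemma psi_coeff_sum (u : (LaurentSeries K)ˣ) (g : LP K) (n : ℤ) :
    (psi u g).coeff n = g.coeff.sum fun j a => a * ((u : LaurentSeries K) ^ j).coeff n := by
  induction g using LaurentPolynomial.induction_on' with
  | add a b ha hb =>
    rw [map_add, HahnSeries.coeff_add, ha, hb, AddMonoidAlgebra.coeff_add, Finsupp.sum_add_index']
    · simp
    · intros; ring
  | C_mul_T n a =>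
    rw [psi, LaurentPolynomial.eval₂_C_mul_T, ← LaurentPolynomial.single_eq_C_mul_T,
      AddMonoidAlgebra.coeff_single, Finsupp.sum_single_index (by simp)]
    simp

lemma coeff_zero_of_psi (u : (LaurentSeries K)ˣ) (hu : (u : LaurentSeries K).order = -1)
    (g : LP K) (n : ℤ) (h : Vge (psi u g) n) : ∀ j, -n < j → g.coeff j = 0 := by
  by_contra! hc
  obtain ⟨j, hj, hgj⟩ := hc
  have hne : g.coeff.support.Nonempty := ⟨j, by simpa using hgj⟩
  set M := g.coeff.support.max' hne with hM
  have hMs : M ∈ g.coeff.support := Finset.max'_mem _ _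
  have hjM : j ≤ M := Finset.le_max' _ _ (by simpa using hgj)
  have h0 := h (-M) (by omega)
  rw [psi_coeff_sum, Finsupp.sum, Finset.sum_eq_single M] at h0
  · rcases mul_eq_zero.1 h0 with h1 | h1
    · simp at hMs; exact hMs h1
    · have := order_zpow' u.ne_zero M
      rw [hu] at this
      rw [show -M = ((u : LaurentSeries K) ^ M).order by rw [this]; ring] at h1
      exact zpow_ne_zero M u.ne_zero (HahnSeries.coeff_order_eq_zero.1 h1)
  · intro b hb hbM
    have hb2 : b ≤ M := Finset.le_max' _ _ hb
    rw [HahnSeries.coeff_eq_zero_of_lt_order, mul_zero]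
    rw [order_zpow' u.ne_zero, hu]; omega
  · intro hh; exact absurd hMs hh

lemma phi_X_pow (p : ℕ) [Fact p.Prime] [CharP K p] (k : ℕ) :
    phi K X ^ (2 * p ^ k) = LaurentPolynomial.C ((2⁻¹ : K) ^ (2 * p ^ k)) *
      (LaurentPolynomial.T (2 * p ^ k : ℤ) - 2 + LaurentPolynomial.T (-(2 * p ^ k : ℤ))) := by
  have : CharP (LP K) p := charP_of_injective_algebraMap (algebraMap K (LP K)).injective p
  rw [phi_X, mul_pow, ← map_pow]
  congr 1
  rw [mul_comm 2, pow_mul, sub_pow_char_pow, LaurentPolynomial.T_pow, LaurentPolynomial.T_pow]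
  have h1 : (LaurentPolynomial.T (p^k : ℤ) : LP K) * LaurentPolynomial.T (-(p^k : ℤ)) = 1 := by
    rw [← LaurentPolynomial.T_add]; simp
  have h2 : (LaurentPolynomial.T (2 * p^k : ℤ) : LP K) = LaurentPolynomial.T (p^k : ℤ) ^ 2 := by
    rw [LaurentPolynomial.T_pow]; norm_num
  have h3 : (LaurentPolynomial.T (-(2 * p^k) : ℤ) : LP K) = LaurentPolynomial.T (-p^k : ℤ) ^ 2 := by
    rw [LaurentPolynomial.T_pow]; norm_num
  rw [h2, h3]
  push_cast
  rw [mul_one, mul_neg, mul_one]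
  linear_combination (-2) * h1

lemma coeff_mul_T (f : LP K) (n j : ℤ) : (f * LaurentPolynomial.T n).coeff j = f.coeff (j - n) := by
  have := AddMonoidAlgebra.coeff_mul_single_eq_coeff_mul (x := f) (r := (1 : K)) (m := n)
    (m₁ := j) (j - n) (fun a _ => by constructor <;> intro h <;> omega)
  rw [mul_one] at this
  exact this

lemma coeff_mul_phi (p : ℕ) [Fact p.Prime] [CharP K p] (k : ℕ) (g : LP K) (j : ℤ) :
    (g * phi K X ^ (2 * p ^ k)).coeff j = (2⁻¹ : K) ^ (2 * p ^ k) *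
      (g.coeff (j - 2 * p ^ k) - 2 * g.coeff j + g.coeff (j + 2 * p ^ k)) := by
  rw [phi_X_pow, show g * (LaurentPolynomial.C ((2⁻¹ : K) ^ (2 * p ^ k)) *
      (LaurentPolynomial.T (2 * p ^ k : ℤ) - 2 + LaurentPolynomial.T (-(2 * p ^ k : ℤ))))
      = LaurentPolynomial.C ((2⁻¹ : K) ^ (2 * p ^ k)) * (g * LaurentPolynomial.T (2 * p ^ k : ℤ)
       - LaurentPolynomial.C 2 * g + g * LaurentPolynomial.T (-(2 * p ^ k : ℤ))) by
        rw [map_ofNat]; ring]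
  rw [← LaurentPolynomial.smul_eq_C_mul, ← LaurentPolynomial.smul_eq_C_mul]
  simp [coeff_mul_T]; ring

lemma regular_core (p : ℕ) [Fact p.Prime] [CharP K p] (h2K : (2 : K) ≠ 0) (k : ℕ)
    (s : LaurentSeries K) (hs0 : s ≠ 0) (hs : s.order = -1)
    (u : (LaurentSeries K)ˣ) (huo : (u : LaurentSeries K).order = -1)
    (hu : (u : LaurentSeries K) - (u : LaurentSeries K)⁻¹ = 2 * tLS K)
    (hu2 : (u : LaurentSeries K) + (u : LaurentSeries K)⁻¹ = 2 * s)
    (c : ℕ) (ρ h : ℤ) (hρ : 0 ≤ ρ) (hρq : ρ < (p ^ k : ℕ)) (hh : h = (p ^ k : ℕ) * c + ρ + 1)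
    (hc1 : (c + 1 : K) ≠ 0) (hc2 : (c + 2 : K) ≠ 0 ∨ (ρ = 0 ∧ (c + 2 : K) = 0 ∧ Even (h - 1)))
    (Q P : K[X]) (hQ : Vge (ev Q) (-(h - 1)))
    (hE : Vge (ev Q * (tLS K ^ (2 * p ^ k) * s⁻¹) - ev P) (h + 1)) : Q = 0 := by
  have hpp := psi_phi h2K u hu
  have hsym : ∀ j, (phi K Q).coeff j = (-1) ^ j * (phi K Q).coeff (-j) := by
    intro j
    rw [← sig_coeff, sig_phi]
  have hg1 : ∀ j, h ≤ j → (phi K Q).coeff j = 0 := by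
    intro j hj
    apply coeff_zero_of_psi u huo (phi K Q) (-(h-1)) _ j (by omega)
    rw [hpp]; exact hQ
  have hg2 : ∀ j, h ≤ |j| → (phi K Q).coeff j = 0 := by
    intro j hj
    rcases le_abs.1 hj with h' | h'
    · exact hg1 j h'
    · rw [hsym, hg1 (-j) h', mul_zero]
  set W : LP K := LaurentPolynomial.C (2⁻¹ : K) * (LaurentPolynomial.T 1 + LaurentPolynomial.T (-1)) with hW
  have hsW : sig K W = -W := by
    rw [hW]; simp only [map_mul, map_add, sig_C, sig_T1, sig_Tm1]; ring
  have hpW : psi u W = s := by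
    rw [hW]; simp only [map_mul, map_add, psi_C, psi_T1, psi_Tm1, hu2]
    have : (2 : LaurentSeries K) = HahnSeries.C (2:K) := (map_ofNat _ 2).symm
    rw [this, ← mul_assoc, ← map_mul, inv_mul_cancel₀ h2K]
    simp
  set y : LP K := phi K P * W - phi K Q * phi K X ^ (2 * p ^ k) with hy
  have hyV : Vge (psi u y) h := by
    have e : psi u y = -(s * (ev Q * (tLS K ^ (2 * p ^ k) * s⁻¹) - ev P)) := by
      rw [hy]; simp only [map_sub, map_mul, map_pow, hpp, hpW]
      simp only [ev, aeval_X]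
      field_simp
      ring
    rw [e]
    have := ((hs ▸ Vge_order s).mul hE).neg
    exact this.mono (by omega)
  have hy0 := coeff_zero_of_psi u huo y h hyV
  have hsy : sig K y = -(phi K P * W) - phi K Q * phi K X ^ (2 * p ^ k) := by
    rw [hy]; simp only [map_sub, map_mul, map_pow, sig_phi, hsW]; ring
  have hsum : y + sig K y = LaurentPolynomial.C (-2) * (phi K Q * phi K X ^ (2 * p ^ k)) := by
    rw [hsy, hy, map_neg, map_ofNat]; ring
  have hrec : ∀ j, |j| < h → (phi K Q).coeff (j - 2 * (p ^ k : ℕ)) - 2 * (phi K Q).coeff j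
      + (phi K Q).coeff (j + 2 * (p ^ k : ℕ)) = 0 := by
    intro j hj
    have hj' := abs_lt.1 hj
    have h1 := congrArg (fun z : LP K => z.coeff j) hsum
    simp only [← LaurentPolynomial.smul_eq_C_mul, AddMonoidAlgebra.coeff_add, Finsupp.add_apply,
      AddMonoidAlgebra.coeff_smul, Finsupp.smul_apply, sig_coeff, coeff_mul_phi, smul_eq_mul] at h1
    rw [hy0 j (by omega), hy0 (-j) (by omega), mul_zero, add_zero] at h1
    have h3 := h1.symm
    simp only [mul_eq_zero, neg_eq_zero, h2K, false_or] at h3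
    rcases h3 with h3 | h3
    · exact absurd h3 (pow_ne_zero _ (inv_ne_zero h2K))
    · push_cast; exact h3
  have hz := seq_zero h2K (p ^ k) c ρ h hρ hρq hh (fun j => (phi K Q).coeff j) hg2 hrec hc1 (by
    rcases hc2 with h' | ⟨a, b, e⟩
    · exact Or.inl h'
    · refine Or.inr ⟨a, b, ?_⟩
      have := hsym (h - 1)
      rw [e.neg_one_zpow, one_mul] at this
      exact this.symm)
  have hz' : phi K Q = 0 := by
    ext j; simpa using hz j
  apply ev_inj
  rw [← hpp, hz', map_zero]

/-- `s` is a square root of `t^2+1` and `u = t + s` the fundamental unit. -/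
structure Setup (s u : LaurentSeries K) : Prop where
  two : (2 : K) ≠ 0
  s0 : s ≠ 0
  so : s.order = -1
  s2 : s ^ 2 = tLS K ^ 2 + 1
  u0 : u ≠ 0
  uo : u.order = -1
  hu : u = tLS K + s
  hui : u⁻¹ = s - tLS K

lemma order_add_of_Vge {f g : LaurentSeries K} (hf : f ≠ 0) (hg : Vge g (f.order + 1)) :
    (f + g).order = f.order := by
  apply order_eq_of
  · rw [HahnSeries.coeff_add, hg _ (by omega), add_zero]
    simpa [HahnSeries.coeff_order_eq_zero] using hf
  · intro m hm
    rw [HahnSeries.coeff_add, hg _ (by omega), HahnSeries.coeff_eq_zero_of_lt_order hm, add_zero]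

lemma order_pow' {f : LaurentSeries K} (hf : f ≠ 0) (n : ℕ) : (f ^ n).order = n * f.order := by
  have := order_zpow' hf n
  rwa [zpow_natCast] at this

lemma order_two_mul (h2 : (2 : K) ≠ 0) (f : LaurentSeries K) : (2 * f).order = f.order := by
  by_cases hf : f = 0
  · simp [hf]
  have e : (2 : LaurentSeries K) = HahnSeries.C (2 : K) := (map_ofNat _ 2).symm
  rw [e, HahnSeries.order_mul (by simpa using h2) hf, HahnSeries.order_C, zero_add]

lemma two_ne (h2 : (2 : K) ≠ 0) : (2 : LaurentSeries K) ≠ 0 := by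
  have e : (2 : LaurentSeries K) = HahnSeries.C (2 : K) := (map_ofNat _ 2).symm
  rw [e]; simpa using h2

lemma Setup.RI {s u : LaurentSeries K} (S : Setup s u) (p : ℕ) [Fact p.Prime] [CharP K p]
    (hodd : Odd p) (hp : 2 ≤ p) (k m : ℕ) : ∃ R I : K[X], u ^ (m * p ^ (k+1)) = ev R + ev I * s ∧
      (-u⁻¹) ^ (m * p ^ (k+1)) = ev R - ev I * s ∧ (Even m → X ^ (2 * p ^ k) ∣ I) ∧
      (Odd m → X ^ (2 * p ^ k) ∣ R) := by
  induction m with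
  | zero => exact ⟨1, 0, by simp, by simp, by simp, by simp⟩
  | succ m ih =>
    obtain ⟨R, I, h1, h2, h3, h4⟩ := ih
    have : CharP (LaurentSeries K) p :=
      charP_of_injective_algebraMap (algebraMap K (LaurentSeries K)).injective p
    obtain ⟨w, hw⟩ := hodd.pow (n := k + 1)
    have es : s ^ (p ^ (k+1)) = ev ((X ^ 2 + 1) ^ w) * s := by
      rw [hw, pow_succ, pow_mul, S.s2]; simp [ev]
    have e1 : u ^ (p ^ (k+1)) = ev (X ^ (p ^ (k+1))) + ev ((X ^ 2 + 1) ^ w) * s := by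
      rw [S.hu, add_pow_char_pow, es]; simp [ev]
    have e2 : (-u⁻¹) ^ (p ^ (k+1)) = ev (X ^ (p ^ (k+1))) - ev ((X ^ 2 + 1) ^ w) * s := by
      rw [S.hui, neg_sub, sub_pow_char_pow, es]; simp [ev]
    have eD : s * s = ev (X ^ 2 + 1) := by rw [← pow_two, S.s2]; simp [ev]
    have hd : (X : K[X]) ^ (2 * p ^ k) ∣ X ^ (p ^ (k + 1)) := by
      apply pow_dvd_pow
      rw [pow_succ, mul_comm]; exact Nat.mul_le_mul_left _ hp
    refine ⟨R * X ^ (p ^ (k+1)) + I * (X ^ 2 + 1 : K[X]) ^ w * (X ^ 2 + 1 : K[X]),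
      R * (X ^ 2 + 1 : K[X]) ^ w + I * X ^ (p ^ (k+1)), ?_, ?_, ?_, ?_⟩
    · rw [add_mul, one_mul, pow_add, h1, e1]
      simp only [ev, map_add, map_mul] at *
      linear_combination (aeval (tLS K) I * aeval (tLS K) ((X ^ 2 + 1 : K[X]) ^ w)) * eD
    · rw [add_mul, one_mul, pow_add, h2, e2]
      simp only [ev, map_add, map_mul] at *
      linear_combination (aeval (tLS K) I * aeval (tLS K) ((X ^ 2 + 1 : K[X]) ^ w)) * eD
    · intro he
      have ho : Odd m := by rw [← Nat.not_even_iff_odd]; exact Nat.even_add_one.1 he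
      exact dvd_add (Dvd.dvd.mul_right (h4 ho) _) (Dvd.dvd.mul_left hd _)
    · intro ho
      have he : Even m := by
        rw [← Nat.not_odd_iff_even]; exact Nat.odd_add_one.1 ho
      exact dvd_add (Dvd.dvd.mul_left hd _) (Dvd.dvd.mul_right (Dvd.dvd.mul_right (h3 he) _) _)

lemma Setup.next_odd {s u : LaurentSeries K} (S : Setup s u) (p : ℕ) [Fact p.Prime] [CharP K p]
    (hodd : Odd p) (hp : 2 ≤ p) (k m : ℕ) (hm : Odd m) :
    Next (tLS K ^ (2 * p ^ k) * s⁻¹) (m * p ^ (k+1) - 2 * p ^ k) (m * p ^ (k+1) + 1) := by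
  obtain ⟨R, I, h1, h2, -, h4⟩ := S.RI p hodd hp k m
  obtain ⟨Q, rfl⟩ := h4 hm
  set N := m * p ^ (k + 1) with hN
  have hNpos : 0 < N := Nat.mul_pos hm.pos (by positivity)
  have ho2 : ((-u⁻¹) ^ N).order = N := by
    rw [order_pow' (neg_ne_zero.2 (inv_ne_zero S.u0)), HahnSeries.order_neg, order_inv' S.u0, S.uo]; ring
  have ho1 : (u ^ N).order = -(N : ℤ) := by
    rw [order_pow' S.u0, S.uo]; ring
  have hRo : (ev (X ^ (2 * p ^ k) * Q)).order = -(N : ℤ) := by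
    rw [← order_two_mul S.two, ← ho1,
      ← order_add_of_Vge (g := (-u⁻¹) ^ N) (pow_ne_zero _ S.u0) ((Vge_order _).mono (by omega)), h1, h2]
    congr 1; ring
  have hR0 : X ^ (2 * p ^ k) * Q ≠ 0 := by
    intro h0; rw [h0] at hRo; simp at hRo; omega
  have hQ0 : Q ≠ 0 := right_ne_zero_of_mul hR0
  rw [order_ev hR0, natDegree_mul (by simp) hQ0, natDegree_X_pow] at hRo
  have hE : ev Q * (tLS K ^ (2 * p ^ k) * s⁻¹) - ev I = (-u⁻¹) ^ N * s⁻¹ := by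
    rw [h2]; simp only [ev, map_mul, map_pow, aeval_X]
    have := S.s0
    field_simp
  have hne : (-u⁻¹) ^ N ≠ 0 := pow_ne_zero _ (neg_ne_zero.2 (inv_ne_zero S.u0))
  refine Next_of_explicit (by omega) Q I hQ0 (by omega) ?_ ?_
  · rw [hE]; exact mul_ne_zero hne (inv_ne_zero S.s0)
  · rw [hE, HahnSeries.order_mul hne (inv_ne_zero S.s0), order_inv' S.s0, S.so, ho2]; push_cast; ring

lemma Setup.next_even {s u : LaurentSeries K} (S : Setup s u) (p : ℕ) [Fact p.Prime] [CharP K p]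
    (hodd : Odd p) (hp : 2 ≤ p) (k m : ℕ) (hm : Even m) (hm0 : 0 < m) :
    Next (tLS K ^ (2 * p ^ k) * s⁻¹) (m * p ^ (k+1) + 1 - 2 * p ^ k) (m * p ^ (k+1)) := by
  obtain ⟨R, I, h1, h2, h3, -⟩ := S.RI p hodd hp k m
  obtain ⟨J, rfl⟩ := h3 hm
  have hq : 0 < p ^ k := by positivity
  set N := m * p ^ (k + 1) with hN
  have hNpos : 0 < N := Nat.mul_pos hm0 (by positivity)
  have ho2 : ((-u⁻¹) ^ N).order = N := by
    rw [order_pow' (neg_ne_zero.2 (inv_ne_zero S.u0)), HahnSeries.order_neg, order_inv' S.u0, S.uo]; ring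
  have ho1 : (u ^ N).order = -(N : ℤ) := by
    rw [order_pow' S.u0, S.uo]; ring
  have hIs : (ev (X ^ (2 * p ^ k) * J) * s).order = -(N : ℤ) := by
    rw [← order_two_mul S.two, ← ho1,
      ← order_add_of_Vge (g := -(-u⁻¹) ^ N) (pow_ne_zero _ S.u0)
        ((Vge_order _).neg.mono (by omega)), h1, h2]
    congr 1; ring
  have hI0 : X ^ (2 * p ^ k) * J ≠ 0 := by
    intro h0; rw [h0] at hIs; simp at hIs; omega
  have hJ0 : J ≠ 0 := right_ne_zero_of_mul hI0
  rw [HahnSeries.order_mul (ev_ne_zero hI0) S.s0, S.so, order_ev hI0, natDegree_mul (by simp) hJ0,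
    natDegree_X_pow] at hIs
  have hD0 : (X ^ 2 + 1 : K[X]) ≠ 0 := by
    intro h; have := congrArg natDegree h
    rw [show (1 : K[X]) = Polynomial.C 1 by simp, natDegree_X_pow_add_C] at this; simp at this
  have hDd : (X ^ 2 + 1 : K[X]).natDegree = 2 := by
    rw [show (1 : K[X]) = Polynomial.C 1 by simp, natDegree_X_pow_add_C]
  have hE : ev (J * (X ^ 2 + 1)) * (tLS K ^ (2 * p ^ k) * s⁻¹) - ev R = -(-u⁻¹) ^ N := by
    rw [h2]; simp only [ev, map_mul, map_pow, map_add, map_one, aeval_X]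
    rw [← S.s2]
    have := S.s0
    field_simp
    ring
  have hne : (-u⁻¹) ^ N ≠ 0 := pow_ne_zero _ (neg_ne_zero.2 (inv_ne_zero S.u0))
  refine Next_of_explicit (by omega) (J * (X ^ 2 + 1)) R (mul_ne_zero hJ0 hD0) ?_ ?_ ?_
  · rw [natDegree_mul hJ0 hD0, hDd]; omega
  · rw [hE]; exact neg_ne_zero.2 hne
  · rw [hE, HahnSeries.order_neg, ho2]

lemma theta_coeff_one (p : ℕ) [Fact p.Prime] : (cantorTheta p).coeff 1 = 1 := by
  have e : cantorTheta p = HahnSeries.single (1 : ℤ) 1 * HahnSeries.ofPowerSeries ℤ (ZMod p) (cps p) := rfl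
  have hc : (HahnSeries.ofPowerSeries ℤ (ZMod p) (cps p)).coeff 0 = 1 := by
    have := HahnSeries.ofPowerSeries_apply_coeff (Γ := ℤ) (cps p) 0
    simp only [Nat.cast_zero] at this
    rw [this, cps, PowerSeries.coeff_mk, cantor]
  have := HahnSeries.coeff_single_mul_add (r := (1 : ZMod p))
    (x := HahnSeries.ofPowerSeries ℤ (ZMod p) (cps p)) (a := (0 : ℤ)) (b := 1)
  rw [e]
  simpa [hc] using this

lemma setup_cantor (p : ℕ) [Fact p.Prime] (hodd : Odd p) :
    Setup (cantorTheta p)⁻¹ (tLS (ZMod p) + (cantorTheta p)⁻¹) := by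
  have h0 := theta_ne_zero p
  have hsq := theta_sq p hodd
  have ho := theta_order p
  have h2 : (2 : ZMod p) ≠ 0 := by
    intro h
    have : ((2 : ℕ) : ZMod p) = 0 := by exact_mod_cast h
    rw [ZMod.natCast_eq_zero_iff] at this
    have h3 := (Nat.prime_two.eq_one_or_self_of_dvd p this)
    have h4 := (Fact.out : p.Prime).one_lt
    rcases h3 with rfl | rfl
    · omega
    · exact absurd hodd (by decide)
  set s := (cantorTheta p)⁻¹ with hs
  have s0 : s ≠ 0 := inv_ne_zero h0
  have so : s.order = -1 := by rw [hs, order_inv' h0, ho]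
  have s2 : s ^ 2 = tLS (ZMod p) ^ 2 + 1 := by
    rw [hs, inv_pow, inv_eq_of_mul_eq_one_left hsq]
  have hmul : (tLS (ZMod p) + s) * (s - tLS (ZMod p)) = 1 := by linear_combination s2
  have u0 : tLS (ZMod p) + s ≠ 0 := left_ne_zero_of_mul_eq_one hmul
  have sc : s.coeff (-1) = 1 := by
    have h := HahnSeries.coeff_mul_order_add_order (cantorTheta p) s
    rw [hs, mul_inv_cancel₀ h0, ← hs, ho, so, HahnSeries.leadingCoeff_eq, HahnSeries.leadingCoeff_eq, ho, so, theta_coeff_one] at h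
    simpa using h.symm
  have tc : (tLS (ZMod p)).coeff (-1) = 1 := by
    have := coeff_ev (X : (ZMod p)[X]) (-1)
    simpa [ev] using this
  have tV : Vge (tLS (ZMod p)) (-1) := by
    have := Vge_ev (A := (X : (ZMod p)[X])) (n := 1) (by simp)
    simpa [ev] using this
  have sV : Vge s (-1) := so ▸ Vge_order s
  refine ⟨h2, s0, so, s2, u0, ?_, rfl, inv_eq_of_mul_eq_one_right hmul⟩
  apply order_eq_of
  · rw [HahnSeries.coeff_add, tc, sc]; norm_num; exact h2
  · exact tV.add sV

lemma next_reg (p : ℕ) [Fact p.Prime] {s u : LaurentSeries (ZMod p)} (S : Setup s u) (k : ℕ)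
    (c ρ D : ℕ) (hρ : ρ < p ^ k) (hD : D = p ^ k * c + ρ) (h1 : ¬ p ∣ c + 1)
    (h2 : ¬ p ∣ c + 2 ∨ (ρ = 0 ∧ p ∣ c + 2 ∧ Even D)) :
    Next (tLS (ZMod p) ^ (2 * p ^ k) * s⁻¹) D (D + 1) := by
  apply Next_of_regular
  intro Q P hQ hE
  refine regular_core p S.two k s S.s0 S.so (Units.mk0 u S.u0) S.uo ?_ ?_ c ρ (D + 1) (by omega)
    (by exact_mod_cast hρ) (by rw [hD]; push_cast; ring) ?_ ?_ Q P ?_ ?_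
  · rw [Units.val_mk0, S.hui, S.hu]; ring
  · rw [Units.val_mk0, S.hui, S.hu]; ring
  · intro h
    apply h1
    rw [← ZMod.natCast_eq_zero_iff]; exact_mod_cast h
  · rcases h2 with h2 | ⟨a, b, e⟩
    · left
      intro h
      apply h2
      rw [← ZMod.natCast_eq_zero_iff]; exact_mod_cast h
    · right
      refine ⟨by exact_mod_cast a, ?_, by simpa using e⟩
      rw [← ZMod.natCast_eq_zero_iff] at b; exact_mod_cast b
  · simpa using Vge_ev hQ
  · exact hE.mono (by omega)

lemma next_reg' (p : ℕ) [Fact p.Prime] (hp3 : 3 ≤ p) {s u : LaurentSeries (ZMod p)} (S : Setup s u)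
    (k m r : ℕ) (hr : r < (p - 2) * p ^ k ∨ (r = (p - 2) * p ^ k ∧ Even (m * p ^ (k+1) + r))) :
    Next (tLS (ZMod p) ^ (2 * p ^ k) * s⁻¹) (m * p ^ (k+1) + r) (m * p ^ (k+1) + r + 1) := by
  have hq : 0 < p ^ k := by positivity
  rcases hr with hr | ⟨hr, he⟩
  · have hrq : r / p ^ k < p - 2 := by rwa [Nat.div_lt_iff_lt_mul hq]
    have hdm := Nat.div_add_mod r (p ^ k)
    have hpos : 0 ≤ r / p ^ k := Nat.zero_le _
    generalize r / p ^ k = y at hrq hdm hpos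
    refine next_reg p S k (m * p + y) (r % p ^ k) _ (Nat.mod_lt _ hq) ?_ ?_ (Or.inl ?_)
    · rw [pow_succ]; nlinarith
    · rw [add_assoc, Nat.dvd_add_right (Dvd.intro_left m rfl)]
      exact Nat.not_dvd_of_pos_of_lt (by omega) (by omega)
    · rw [add_assoc, Nat.dvd_add_right (Dvd.intro_left m rfl)]
      exact Nat.not_dvd_of_pos_of_lt (by omega) (by omega)
  · refine next_reg p S k (m * p + (p - 2)) 0 _ hq ?_ ?_ (Or.inr ⟨rfl, ?_, he⟩)
    · rw [hr, pow_succ]; ring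
    · rw [add_assoc, Nat.dvd_add_right (Dvd.intro_left m rfl)]
      exact Nat.not_dvd_of_pos_of_lt (by omega) (by omega)
    · rw [add_assoc, Nat.dvd_add_right (Dvd.intro_left m rfl), show p - 2 + 2 = p by omega]

lemma step_in (p : ℕ) [Fact p.Prime] (hodd : Odd p) (hp3 : 3 ≤ p) {s u : LaurentSeries (ZMod p)}
    (S : Setup s u) (k m r : ℕ) (hr : r + 1 < (p - 2) * p ^ k + 1) :
    Next (tLS (ZMod p) ^ (2 * p ^ k) * s⁻¹) (m * p ^ (k+1) + r + m % 2)
      (m * p ^ (k+1) + (r + 1) + m % 2) := by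
  rw [show m * p ^ (k+1) + (r + 1) + m % 2 = m * p ^ (k+1) + (r + m % 2) + 1 by omega, add_assoc]
  apply next_reg' p hp3 S
  rcases Nat.even_or_odd m with he | ho
  · left; rw [Nat.even_iff.1 he]; omega
  · rw [Nat.odd_iff.1 ho]
    by_cases h : r + 1 < (p - 2) * p ^ k
    · exact Or.inl h
    · right
      refine ⟨by omega, ?_⟩
      rw [show r + 1 = (p - 2) * p ^ k by omega]
      apply Odd.add_odd
      · exact ho.mul hodd.pow
      · refine Odd.mul ?_ hodd.pow
        obtain ⟨w, hw⟩ := hodd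
        exact ⟨w - 1, by omega⟩

lemma step_out (p : ℕ) [Fact p.Prime] (hodd : Odd p) (hp3 : 3 ≤ p) {s u : LaurentSeries (ZMod p)}
    (S : Setup s u) (k m : ℕ) :
    Next (tLS (ZMod p) ^ (2 * p ^ k) * s⁻¹) (m * p ^ (k+1) + (p - 2) * p ^ k + m % 2)
      ((m + 1) * p ^ (k+1) + (m + 1) % 2) := by
  have e : m * p ^ (k+1) + (p - 2) * p ^ k + 2 * p ^ k = (m + 1) * p ^ (k + 1) := by
    obtain ⟨w, rfl⟩ := Nat.exists_eq_add_of_le (show 2 ≤ p by omega)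
    rw [show 2 + w - 2 = w by omega]; ring
  rcases Nat.even_or_odd m with he | ho
  · have := S.next_odd p hodd (by omega) k (m + 1) he.add_one
    convert this using 1
    · have := Nat.even_iff.1 he; omega
    · have := Nat.even_iff.1 he; omega
  · have := S.next_even p hodd (by omega) k (m + 1) ho.add_one (by omega)
    convert this using 1
    · have := Nat.odd_iff.1 ho; omega
    · have := Nat.odd_iff.1 ho; omega

lemma inv_all (p : ℕ) [Fact p.Prime] (hodd : Odd p) (hp3 : 3 ≤ p) {s u : LaurentSeries (ZMod p)}
    (S : Setup s u) (k m r : ℕ) (hr : r < (p - 2) * p ^ k + 1) :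
    Inv (tLS (ZMod p) ^ (2 * p ^ k) * s⁻¹) (((p - 2) * p ^ k + 1) * m + r)
      (m * p ^ (k+1) + r + m % 2) := by
  have inner : ∀ m, Inv (tLS (ZMod p) ^ (2 * p ^ k) * s⁻¹) (((p - 2) * p ^ k + 1) * m + 0)
      (m * p ^ (k+1) + 0 + m % 2) → ∀ r, r < (p - 2) * p ^ k + 1 →
      Inv (tLS (ZMod p) ^ (2 * p ^ k) * s⁻¹) (((p - 2) * p ^ k + 1) * m + r)
      (m * p ^ (k+1) + r + m % 2) := by
    intro m h0 r
    induction r with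
    | zero => intro _; exact h0
    | succ r ih => intro hr; exact (Inv_step (ih (by omega)) (step_in p hodd hp3 S k m r hr)).1
  refine inner m ?_ r hr
  clear hr
  induction m with
  | zero => simpa using Inv_zero _
  | succ m ih =>
    have := (Inv_step (inner m ih _ (Nat.lt_succ_self _)) (step_out p hodd hp3 S k m)).1
    convert this using 1
    · ring
    · rw [add_zero]

lemma deg_all (p : ℕ) [Fact p.Prime] (hodd : Odd p) (hp3 : 3 ≤ p) {s u : LaurentSeries (ZMod p)}
    (S : Setup s u) (k i : ℕ) (hi : 1 ≤ i) :
    degZ (cfPQ (tLS (ZMod p) ^ (2 * p ^ k) * s⁻¹) i) = dg ((p - 2) * p ^ k + 1) (p ^ k) i := by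
  obtain ⟨j, rfl⟩ := Nat.exists_eq_add_of_le' hi
  set B := (p - 2) * p ^ k + 1 with hB
  have hBpos : 0 < B := by omega
  have hdm := Nat.div_add_mod j B
  set m := j / B
  set r := j % B
  have hr : r < B := Nat.mod_lt _ hBpos
  have hinv := inv_all p hodd hp3 S k m r hr
  rw [← hB, hdm] at hinv
  by_cases h : r + 1 < B
  · have := (Inv_step hinv (step_in p hodd hp3 S k m r h)).2
    rw [this, dg, if_neg]
    · push_cast; ring
    · rw [← hdm, add_assoc, Nat.dvd_add_right (Dvd.intro m rfl)]
      exact Nat.not_dvd_of_pos_of_lt (by omega) h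
  · have hrB : r = (p - 2) * p ^ k := by omega
    have hj : j + 1 = B * (m + 1) := by rw [← hdm]; rw [mul_add]; omega
    have := (Inv_step hinv (by rw [hrB]; exact step_out p hodd hp3 S k m)).2
    have e : m * p ^ (k+1) + (p - 2) * p ^ k + 2 * p ^ k = (m + 1) * p ^ (k + 1) := by
      obtain ⟨w, rfl⟩ := Nat.exists_eq_add_of_le (show 2 ≤ p by omega)
      rw [show 2 + w - 2 = w by omega]; ring
    rw [this, dg, if_pos ⟨_, hj⟩, hj, Nat.mul_div_cancel_left _ hBpos, hrB, ← e]
    rcases Nat.even_or_odd m with he | ho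
    · rw [if_pos he.add_one, Nat.even_iff.1 he, Nat.odd_iff.1 he.add_one]; push_cast; ring
    · have hq : 0 < p ^ k := by positivity
      rw [if_neg (Nat.not_odd_iff_even.2 ho.add_one), Nat.odd_iff.1 ho, Nat.even_iff.1 ho.add_one,
        Nat.cast_sub (by omega)]; push_cast; ring

lemma finite_polys [Finite K] (n : ℕ) : {A : K[X] | A.natDegree ≤ n}.Finite := by
  have : Finite (degreeLT K (n + 1)) := Finite.of_equiv _ (degreeLTEquiv K (n+1)).symm.toEquiv
  apply Set.Finite.subset (Set.toFinite (degreeLT K (n + 1) : Set K[X]))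
  intro A hA
  simp only [SetLike.mem_coe, mem_degreeLT, Set.mem_ofPred_eq] at *
  exact lt_of_le_of_lt degree_le_natDegree (by exact_mod_cast Nat.lt_succ_of_le hA)

lemma finite_quad [Finite K] (n : ℕ) : {z : LaurentSeries K | ∃ a b c : K[X], a.natDegree ≤ n ∧
    b.natDegree ≤ n ∧ c.natDegree ≤ n ∧ a ≠ 0 ∧ ev a * z ^ 2 + ev b * z + ev c = 0}.Finite := by
  have hS := finite_polys (K := K) n
  have hS3 := (hS.prod (hS.prod hS))
  refine Set.Finite.subset (Set.Finite.biUnion hS3 (t := fun x => {z : LaurentSeries K | x.1 ≠ 0 ∧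
    ev x.1 * z ^ 2 + ev x.2.1 * z + ev x.2.2 = 0}) ?_) ?_
  · rintro ⟨a, b, c⟩ -
    by_cases ha : a = 0
    · simp [ha]
    have hne : (Polynomial.C (ev a) * X ^ 2 + Polynomial.C (ev b) * X + Polynomial.C (ev c) :
        (LaurentSeries K)[X]) ≠ 0 := by
      intro h
      have := congrArg (fun P => Polynomial.coeff P 2) h
      simp [coeff_X, coeff_C] at this
      exact ev_ne_zero ha this
    apply Set.Finite.subset (Polynomial.finite_setOfPred_isRoot hne)
    rintro z ⟨-, hz⟩
    simpa [IsRoot] using hz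
  · rintro z ⟨a, b, c, ha, hb, hc, h0, hz⟩
    simp only [Set.mem_iUnion]
    exact ⟨(a, b, c), ⟨ha, hb, hc⟩, h0, hz⟩

lemma cfQuot_add (f : LaurentSeries K) (i j : ℕ) (h : cfQuot f i = cfQuot f j) (n : ℕ) :
    cfQuot f (i + n) = cfQuot f (j + n) := by
  induction n with
  | zero => exact h
  | succ n ih => rw [← add_assoc, ← add_assoc, cfQuot, cfQuot, ih]

lemma quad_of_inv {s u : LaurentSeries K} (S : Setup s u) (q : ℕ) (hq : 0 < q) (i D : ℕ)
    (hI : Inv (tLS K ^ (2 * q) * s⁻¹) i D)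
    (hne : cfQuot (tLS K ^ (2 * q) * s⁻¹) i - polyPart (cfQuot (tLS K ^ (2 * q) * s⁻¹) i) ≠ 0) :
    cfQuot (tLS K ^ (2 * q) * s⁻¹) (i + 1) ∈ {z : LaurentSeries K | ∃ a b c : K[X],
      a.natDegree ≤ 2 * q + 1 ∧ b.natDegree ≤ 2 * q + 1 ∧ c.natDegree ≤ 2 * q + 1 ∧ a ≠ 0 ∧
      ev a * z ^ 2 + ev b * z + ev c = 0} := by
  set f := tLS K ^ (2 * q) * s⁻¹ with hf
  obtain ⟨Q, P, Q', P', hQ0, hQD, hQ', hE'0, hE'o, hE⟩ := hI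
  have hw := Vge_frac (cfQuot f i)
  rw [cfQuot]
  set w := cfQuot f i - polyPart (cfQuot f i) with hwdef
  have ht : ev (X : K[X]) = tLS K := by simp [ev]
  have ht0 : tLS K ≠ 0 := by rw [← ht]; exact ev_ne_zero X_ne_zero
  have hto : (tLS K).order = -1 := by rw [← ht, order_ev X_ne_zero]; simp
  have hf0 : f ≠ 0 := mul_ne_zero (pow_ne_zero _ ht0) (inv_ne_zero S.s0)
  have hfo : f.order = -(2 * q : ℤ) + 1 := by
    rw [hf, HahnSeries.order_mul (pow_ne_zero _ ht0) (inv_ne_zero S.s0), order_inv' S.s0, S.so,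
      order_pow' ht0, hto]; push_cast; ring
  have hf2 : f ^ 2 * (tLS K ^ 2 + 1) = tLS K ^ (4 * q) := by
    rw [← S.s2, hf]
    have := S.s0
    field_simp
    ring
  set E := ev Q * f - ev P with hEd
  set E' := ev Q' * f - ev P' with hE'd
  have hVE' : Vge E' D := hE'o ▸ Vge_order E'
  have hVE : Vge E (D + 1) := by
    rw [hE]; exact (hw.neg.mul hVE').mono (by omega)
  have hVf : Vge f (-(2 * q : ℤ) + 1) := hfo ▸ Vge_order f
  have hVQ : Vge (ev Q * f) (-D + (-(2 * q : ℤ) + 1)) := (Vge_ev hQD.le).mul hVf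
  have hVQ' : Vge (ev Q' * f) (-D + (-(2 * q : ℤ) + 1)) := by
    refine (Vge_ev (A := Q') (n := D) ?_).mul hVf
    rcases hQ' with h | h
    · simp [h]
    · omega
  have hVF : Vge (ev Q * f + ev P) (-D + (-(2 * q : ℤ) + 1)) := by
    rw [show ev Q * f + ev P = ev Q * f + ev Q * f - E by rw [hEd]; ring]
    exact (hVQ.add hVQ).sub (hVE.mono (by omega))
  have hVF' : Vge (ev Q' * f + ev P') (-D + (-(2 * q : ℤ) + 1)) := by
    rw [show ev Q' * f + ev P' = ev Q' * f + ev Q' * f - E' by rw [hE'd]; ring]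
    exact (hVQ'.add hVQ').sub (hVE'.mono (by omega))
  have hD : ev (X ^ 2 + 1 : K[X]) = tLS K ^ 2 + 1 := by simp [ev]
  have hVD : Vge (tLS K ^ 2 + 1) (-2) := by
    rw [← hD]; apply Vge_ev (n := 2)
    rw [show (1 : K[X]) = Polynomial.C 1 by simp, natDegree_X_pow_add_C]
  have hD0 : tLS K ^ 2 + 1 ≠ 0 := by rw [← S.s2]; exact pow_ne_zero _ S.s0
  have hE0 : E ≠ 0 := by rw [hE]; exact mul_ne_zero (neg_ne_zero.2 hne) hE'0
  have hF0 : ev Q * f + ev P ≠ 0 := by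
    intro h
    have h1 : E = 2 * (ev Q * f) := by rw [hEd]; linear_combination -h
    have h2 := hVE.le_order hE0
    rw [h1, order_two_mul S.two, HahnSeries.order_mul (ev_ne_zero hQ0) hf0, order_ev hQ0, hfo] at h2
    omega
  have ea : ev (Q ^ 2 * X ^ (4 * q) - (X ^ 2 + 1) * P ^ 2) =
      (tLS K ^ 2 + 1) * (E * (ev Q * f + ev P)) := by
    rw [hEd]; simp only [ev, map_sub, map_mul, map_pow, map_add, map_one, aeval_X]
    linear_combination -(aeval (tLS K) Q) ^ 2 * hf2
  have eb : ev (2 * (Q * Q' * X ^ (4 * q) - (X ^ 2 + 1) * P * P')) =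
      (tLS K ^ 2 + 1) * (E * (ev Q' * f + ev P') + E' * (ev Q * f + ev P)) := by
    rw [hEd, hE'd]; simp only [ev, map_sub, map_mul, map_pow, map_add, map_one, aeval_X, map_ofNat]
    linear_combination -2 * (aeval (tLS K) Q) * (aeval (tLS K) Q') * hf2
  have ec : ev (Q' ^ 2 * X ^ (4 * q) - (X ^ 2 + 1) * P' ^ 2) =
      (tLS K ^ 2 + 1) * (E' * (ev Q' * f + ev P')) := by
    rw [hE'd]; simp only [ev, map_sub, map_mul, map_pow, map_add, map_one, aeval_X]
    linear_combination -(aeval (tLS K) Q') ^ 2 * hf2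
  refine ⟨Q ^ 2 * X ^ (4 * q) - (X ^ 2 + 1) * P ^ 2,
    2 * (Q * Q' * X ^ (4 * q) - (X ^ 2 + 1) * P * P'),
    Q' ^ 2 * X ^ (4 * q) - (X ^ 2 + 1) * P' ^ 2,
    natDegree_le_of_Vge ?_, natDegree_le_of_Vge ?_, natDegree_le_of_Vge ?_, ?_, ?_⟩
  · rw [ea]; exact (hVD.mul (hVE.mul hVF)).mono (by push_cast; omega)
  · rw [eb]
    exact (hVD.mul (((hVE.mul hVF').mono (by omega)).add (hVE'.mul hVF))).mono (by push_cast; omega)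
  · rw [ec]; exact (hVD.mul (hVE'.mul hVF')).mono (by push_cast; omega)
  · intro h
    rw [h] at ea
    exact mul_ne_zero hD0 (mul_ne_zero hE0 hF0) (by rw [← ea]; simp [ev])
  · rw [ea, eb, ec]
    have hz : E' = -E * w⁻¹ := by rw [hE]; field_simp
    rw [hz]
    ring

lemma period_exists (p : ℕ) [Fact p.Prime] (hodd : Odd p) (hp3 : 3 ≤ p)
    {s u : LaurentSeries (ZMod p)} (S : Setup s u) (k : ℕ) :
    ∃ x : ℕ × ℕ, PeriodWindow (tLS (ZMod p) ^ (2 * p ^ k) * s⁻¹) x.1 x.2 := by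
  have hq : 0 < p ^ k := by positivity
  set f := tLS (ZMod p) ^ (2 * p ^ k) * s⁻¹ with hf
  have hmem : ∀ i, cfQuot f (i + 1) ∈ {z : LaurentSeries (ZMod p) | ∃ a b c : (ZMod p)[X],
      a.natDegree ≤ 2 * p ^ k + 1 ∧ b.natDegree ≤ 2 * p ^ k + 1 ∧ c.natDegree ≤ 2 * p ^ k + 1 ∧
      a ≠ 0 ∧ ev a * z ^ 2 + ev b * z + ev c = 0} := by
    intro i
    have hI := inv_all p hodd hp3 S k (i / ((p - 2) * p ^ k + 1)) (i % ((p - 2) * p ^ k + 1))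
      (Nat.mod_lt _ (Nat.succ_pos _))
    rw [Nat.div_add_mod] at hI
    refine quad_of_inv S (p ^ k) hq i _ hI ?_
    intro h0
    have hd := deg_all p hodd hp3 S k (i + 1) (by omega)
    rw [← hf] at h0 hd
    rw [cfPQ, cfQuot, h0, inv_zero] at hd
    have hpp : polyPart (0 : LaurentSeries (ZMod p)) = 0 := by
      ext n; rw [coeff_polyPart]; simp
    rw [hpp, degZ, HahnSeries.order_zero] at hd
    have : dg ((p - 2) * p ^ k + 1) (p ^ k) (i + 1) = 0 := by
      have : ((dg ((p - 2) * p ^ k + 1) (p ^ k) (i + 1) : ℕ) : ℤ) = 0 := by rw [← hd]; rfl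
      exact_mod_cast this
    unfold dg at this
    split_ifs at this <;> omega
  obtain ⟨i, j, hij, he⟩ := (finite_quad (K := ZMod p) (2 * p ^ k + 1)).exists_lt_map_eq_of_forall_mem hmem
  refine ⟨(i, j - i), by simp; omega, ?_⟩
  intro n hn
  have := cfQuot_add f (j + 1) (i + 1) he.symm (n - (i + 1))
  simp only at hn
  rw [show j + 1 + (n - (i + 1)) = n + (j - i) by omega, show i + 1 + (n - (i + 1)) = n by omega] at this
  simp only [cfPQ, this]

lemma eMass_cantor (p : ℕ) [Fact p.Prime] (hodd : Odd p) (k n : ℕ) (hn : 2 ≤ n) (hk : n < p ^ k) :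
    eMass (cantorTheta p) (2 * p ^ k) n = 2 / p - (n / p) * ((p : ℝ) ^ k)⁻¹ := by
  have hp := (Fact.out : p.Prime)
  have hp3 : 3 ≤ p := by
    have := hp.two_le
    rcases this.eq_or_lt with h | h
    · rw [← h] at hodd; exact absurd hodd (by decide)
    · exact h
  have S := setup_cantor p hodd
  have hper := period_exists p hodd hp3 S k
  have hdeg := deg_all p hodd hp3 S k
  rw [inv_inv] at hper hdeg
  rw [eMass, eMassP, eMassOf_eq _ ((p - 2) * p ^ k + 1) (p ^ k) n (by omega) hn hk hper hdeg]
  have hp0 : (p : ℝ) ≠ 0 := by exact_mod_cast hp.ne_zero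
  have hq0 : (p : ℝ) ^ k ≠ 0 := pow_ne_zero _ hp0
  push_cast [Nat.cast_sub (show 2 ≤ p by omega)]
  rw [show 2 * (((p : ℝ) - 2) * p ^ k + 1 - 1) + 4 * p ^ k = 2 * p * p ^ k by ring]
  field_simp
  ring

lemma tendsto_eMass (p : ℕ) [Fact p.Prime] (hodd : Odd p) (n : ℕ) (hn : 2 ≤ n) :
    Filter.Tendsto (fun k : ℕ => eMass (cantorTheta p) (2 * p ^ k) n)
      Filter.atTop (nhds (2 / p)) := by
  have hp := (Fact.out : p.Prime)
  have h1 : Tendsto (fun k : ℕ => (2 / p : ℝ) - (n / p) * ((p : ℝ) ^ k)⁻¹) atTop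
      (nhds (2 / p - n / p * 0)) := by
    apply Tendsto.sub tendsto_const_nhds
    apply Tendsto.mul tendsto_const_nhds
    apply Tendsto.inv_tendsto_atTop
    exact tendsto_pow_atTop_atTop_of_one_lt (by exact_mod_cast hp.one_lt)
  rw [mul_zero, sub_zero] at h1
  refine h1.congr' ?_
  filter_upwards [eventually_gt_atTop n] with k hk
  exact (eMass_cantor p hodd k n hn (lt_trans hk (Nat.lt_pow_self hp.one_lt))).symm

/-- For every `n ≥ 2`, `lim_k e_{2p^k, n}(Θ_p) = 2/p`; consequently the
sequence of diagonals `{2p^k}` exhibits exactly `2/p` escape of mass. -/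
theorem pCantor_two_p_pow_diagonals (p : ℕ) [Fact p.Prime] (hodd : Odd p) :
    (∀ n : ℕ, 2 ≤ n →
        Filter.Tendsto (fun k : ℕ => eMass (cantorTheta p) (2 * p ^ k) n)
          Filter.atTop (nhds (2 / p))) ∧
    ∃ L : ℕ → ℝ,
      (∀ n : ℕ, 2 ≤ n →
        Filter.Tendsto (fun k : ℕ => eMass (cantorTheta p) (2 * p ^ k) n)
          Filter.atTop (nhds (L n))) ∧
      Filter.Tendsto L Filter.atTop (nhds (2 / p)) := by
  exact ⟨fun n hn => tendsto_eMass p hodd n hn, fun _ => 2 / p,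
    fun n hn => tendsto_eMass p hodd n hn, tendsto_const_nhds⟩

end EscapeOfMass
end
end
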